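/- Let 1 < q < p < ∞. There exists a constant C (depending only on p, q and φ₀) such that for every finite set E of Haar indices whose Haar frequency exponent set A = HF(E) satisfies #A ≥ 2, and every Schwartz function f : ℝ → ℂ, one has ‖P_E f‖_{F^{−1+1/q}_{p,q}} ≤ C · (log₂ #A)^{1−1/q} · Z̄(A)^{1/q} · ‖f‖_{F^{−1+1/q}_{p,q}}, where Z̄(A) = max_{n ∈ ℤ} #{ j ∈ A : |j − n| ≤ log₂ #A }. -/

import Mathlib

open MeasureTheory Real FourierTransform
open scoped ENNReal

noncomputable section

def haarFn (j : ℕ) (μ : ℤ) : ℝ → ℂ := fun x =>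
  (Set.Ico ((2:ℝ)^(-(j:ℤ)) * μ) ((2:ℝ)^(-(j:ℤ)) * (μ + 1/2))).indicator (fun _ => (1:ℂ)) x
  - (Set.Ico ((2:ℝ)^(-(j:ℤ)) * (μ + 1/2)) ((2:ℝ)^(-(j:ℤ)) * (μ + 1))).indicator (fun _ => (1:ℂ)) x

def haarProj (E : Finset (ℕ × ℤ)) (f : ℝ → ℂ) : ℝ → ℂ := fun x =>
  ∑ e ∈ E, (2:ℂ)^e.1 * (∫ y : ℝ, f y * haarFn e.1 e.2 y) * haarFn e.1 e.2 x

def HFset (E : Finset (ℕ × ℤ)) : Finset ℕ := E.image Prod.fst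

def conv (f g : ℝ → ℂ) : ℝ → ℂ := fun x => ∫ t : ℝ, f t * g (x - t)

def LPop (φ₀ : ℝ → ℂ) (k : ℕ) (g : ℝ → ℂ) : ℝ → ℂ :=
  if k = 0 then conv g (𝓕⁻ φ₀)
  else conv g (fun x => (2:ℂ)^k * (𝓕⁻ (fun ξ => φ₀ ξ - φ₀ (2*ξ))) ((2:ℝ)^k * x))

def FNorm (φ₀ : ℝ → ℂ) (p q s : ℝ) (g : ℝ → ℂ) : ℝ≥0∞ :=
  (∫⁻ x : ℝ, (∑' k : ℕ, ENNReal.ofReal ((2:ℝ)^((k:ℝ)*s*q)) *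
      (ENNReal.ofReal ‖LPop φ₀ k g x‖)^q)^(p/q) ∂volume)^(1/p)

/-- $\bar{\mathcal Z}(A)=\max_{n\in\mathbb Z}\#\{j\in A: |j-n|\le \log_2\#A\}$. -/
def Zbar (A : Finset ℕ) : ℕ :=
  sSup {c : ℕ | ∃ n : ℤ, c = (A.filter (fun (j : ℕ) => |(j:ℝ) - (n:ℝ)| ≤ Real.logb 2 (A.card : ℝ))).card}

/-- The Jensen inequality for a weight `a` of arbitrary mass. -/
theorem rpow_lintegral_mul_le {α : Type*} [MeasurableSpace α] (μ : Measure α) {a f : α → ℝ≥0∞}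
    (ha : AEMeasurable a μ) (hf : AEMeasurable f μ) {q : ℝ} (hq : 1 < q) :
    (∫⁻ x, a x * f x ∂μ) ^ q ≤ (∫⁻ x, a x ∂μ) ^ (q - 1) * ∫⁻ x, a x * f x ^ q ∂μ := by
  have hq0 : 0 < q := by linarith
  have h1 : 0 ≤ 1 - 1 / q := by
    rw [sub_nonneg, div_le_one hq0]; exact hq.le
  have key := ENNReal.lintegral_mul_norm_pow_le (μ := μ) (f := a) (g := fun x => a x * f x ^ q)
    ha (ha.mul (hf.pow_const q)) h1 (by positivity : 0 ≤ 1 / q) (by ring)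
  have e : ∀ x, a x ^ (1 - 1 / q) * (a x * f x ^ q) ^ (1 / q) = a x * f x := by
    intro x
    rw [ENNReal.mul_rpow_of_nonneg _ _ (by positivity), ← ENNReal.rpow_mul,
      mul_one_div_cancel hq0.ne', ENNReal.rpow_one, ← mul_assoc,
      ← ENNReal.rpow_add_of_nonneg _ _ h1 (by positivity)]
    simp
  simp only [e] at key
  calc (∫⁻ x, a x * f x ∂μ) ^ q
      ≤ ((∫⁻ x, a x ∂μ) ^ (1 - 1 / q) * (∫⁻ x, a x * f x ^ q ∂μ) ^ (1 / q)) ^ q :=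
        ENNReal.rpow_le_rpow key hq0.le
    _ = _ := by
        rw [ENNReal.mul_rpow_of_nonneg _ _ hq0.le, ← ENNReal.rpow_mul, ← ENNReal.rpow_mul,
          one_div_mul_cancel hq0.ne', ENNReal.rpow_one, sub_mul, one_div_mul_cancel hq0.ne',
          one_mul]

theorem rpow_tsum_mul_le {ι : Type*} [Countable ι] (a f : ι → ℝ≥0∞) {q : ℝ} (hq : 1 < q) :
    (∑' i, a i * f i) ^ q ≤ (∑' i, a i) ^ (q - 1) * ∑' i, a i * f i ^ q := by
  let _ : MeasurableSpace ι := ⊤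
  have h := rpow_lintegral_mul_le Measure.count (a := a) (f := f)
    (measurable_from_top.aemeasurable) (measurable_from_top.aemeasurable) hq
  simpa only [lintegral_count] using h

/-- The maximal function over intervals of dyadic radius. -/
def dyadicMax (h : ℝ → ℝ≥0∞) (x : ℝ) : ℝ≥0∞ :=
  ⨆ k : ℤ, ENNReal.ofReal ((2:ℝ) ^ k) * ∫⁻ t in Metric.closedBall x ((2:ℝ) ^ (-k)), h t

theorem measurable_dyadicMax {h : ℝ → ℝ≥0∞} (hh : Measurable h) : Measurable (dyadicMax h) := by
  refine Measurable.iSup fun k => Measurable.const_mul ?_ _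
  have e : ∀ x : ℝ, ∫⁻ t in Metric.closedBall x ((2:ℝ) ^ (-k)), h t =
      ∫⁻ t, {p : ℝ × ℝ | dist p.2 p.1 ≤ (2:ℝ) ^ (-k)}.indicator (fun p => h p.2) (x, t) := by
    intro x
    rw [← lintegral_indicator Metric.isClosed_closedBall.measurableSet]
    rfl
  simp only [e]
  refine Measurable.lintegral_prod_right' (f := fun p : ℝ × ℝ =>
    {p : ℝ × ℝ | dist p.2 p.1 ≤ (2:ℝ) ^ (-k)}.indicator (fun p => h p.2) p) ?_
  refine (hh.comp measurable_snd).indicator ?_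
  exact measurableSet_le (by fun_prop) (by fun_prop)

theorem dyadicMax_le_add (h : ℝ → ℝ≥0∞) {g : ℝ → ℝ≥0∞} {c : ℝ≥0∞}
    (hle : ∀ x, h x ≤ g x + c) (x : ℝ) : dyadicMax h x ≤ dyadicMax g x + 2 * c := by
  refine iSup_le fun k => ?_
  have hk : (0:ℝ) < (2:ℝ) ^ k := by positivity
  calc ENNReal.ofReal ((2:ℝ) ^ k) * ∫⁻ t in Metric.closedBall x ((2:ℝ) ^ (-k)), h t
      ≤ ENNReal.ofReal ((2:ℝ) ^ k) * ∫⁻ t in Metric.closedBall x ((2:ℝ) ^ (-k)), (g t + c) := by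
        gcongr with t; exact hle t
    _ = ENNReal.ofReal ((2:ℝ) ^ k) * (∫⁻ t in Metric.closedBall x ((2:ℝ) ^ (-k)), g t) +
        ENNReal.ofReal ((2:ℝ) ^ k) * (c * ENNReal.ofReal (2 * (2:ℝ) ^ (-k))) := by
        rw [lintegral_add_right _ measurable_const, mul_add, setLIntegral_const,
          Real.volume_closedBall]
    _ ≤ dyadicMax g x + 2 * c := by
        refine add_le_add ?_ ?_
        · exact le_iSup (fun k : ℤ => ENNReal.ofReal ((2:ℝ) ^ k) *
            ∫⁻ t in Metric.closedBall x ((2:ℝ) ^ (-k)), g t) k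
        · rw [mul_left_comm, ← ENNReal.ofReal_mul hk.le]
          have : (2:ℝ) ^ k * (2 * (2:ℝ) ^ (-k)) = 2 := by
            rw [zpow_neg]; field_simp
          rw [this, mul_comm]; simp

/-- Weak type (1,1) bound for the maximal function. -/
theorem volume_lt_dyadicMax_le (h : ℝ → ℝ≥0∞) {l : ℝ} (hl : 0 < l) :
    volume {x | ENNReal.ofReal l < dyadicMax h x} ≤ ENNReal.ofReal (10 / l) * ∫⁻ t, h t := by
  rcases eq_or_ne (∫⁻ t, h t) ∞ with htop | hfin
  · rw [htop, ENNReal.mul_top]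
    · exact le_top
    · simpa using by positivity
  set T := {x | ENNReal.ofReal l < dyadicMax h x} with hT
  have hex : ∀ x : ℝ, ∃ k : ℤ, x ∈ T → ENNReal.ofReal l <
      ENNReal.ofReal ((2:ℝ) ^ k) * ∫⁻ t in Metric.closedBall x ((2:ℝ) ^ (-k)), h t := by
    intro x
    by_cases hx : x ∈ T
    · obtain ⟨k, hk⟩ := lt_iSup_iff.1 (show ENNReal.ofReal l < dyadicMax h x from hx)
      exact ⟨k, fun _ => hk⟩
    · exact ⟨0, fun h => absurd h hx⟩
  choose k hk using hex
  have hrad : ∀ x ∈ T, ENNReal.ofReal ((2:ℝ) ^ (-k x)) ≤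
      ENNReal.ofReal (1 / l) * ∫⁻ t in Metric.closedBall x ((2:ℝ) ^ (-k x)), h t := by
    intro x hx
    have h1 := (hk x hx).le
    have h2 : (0:ℝ) < (2:ℝ) ^ k x := by positivity
    calc ENNReal.ofReal ((2:ℝ) ^ (-k x))
        = ENNReal.ofReal ((2:ℝ) ^ (-k x) * (1 / l)) * ENNReal.ofReal l := by
          rw [← ENNReal.ofReal_mul (by positivity)]; congr 1; field_simp
      _ ≤ ENNReal.ofReal ((2:ℝ) ^ (-k x) * (1 / l)) * (ENNReal.ofReal ((2:ℝ) ^ k x) *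
            ∫⁻ t in Metric.closedBall x ((2:ℝ) ^ (-k x)), h t) := by gcongr
      _ = _ := by
          rw [← mul_assoc, ← ENNReal.ofReal_mul (by positivity)]
          congr 2
          rw [zpow_neg]; field_simp
  obtain ⟨u, huT, hdisj, hcov⟩ := Vitali.exists_disjoint_subfamily_covering_enlargement_closedBall
    T (fun x => x) (fun x => (2:ℝ) ^ (-k x)) ((ENNReal.ofReal (1 / l) * ∫⁻ t, h t).toReal)
    (by
      intro x hx
      rw [← ENNReal.ofReal_le_iff_le_toReal (ENNReal.mul_ne_top ENNReal.ofReal_ne_top hfin)]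
      refine (hrad x hx).trans ?_
      gcongr
      exact Measure.restrict_le_self) 5 (by norm_num)
  have hcount : u.Countable := by
    refine hdisj.countable_of_nonempty_interior fun x _ => ?_
    refine ⟨x, interior_mono Metric.ball_subset_closedBall ?_⟩
    rw [Metric.isOpen_ball.interior_eq]
    exact Metric.mem_ball_self (by positivity)
  have hsub : T ⊆ ⋃ b ∈ u, Metric.closedBall b (5 * (2:ℝ) ^ (-k b)) := by
    intro x hx
    obtain ⟨b, hb, hsub⟩ := hcov x hx
    exact Set.mem_biUnion hb (hsub (Metric.mem_closedBall_self (by positivity)))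
  calc volume T ≤ volume (⋃ b ∈ u, Metric.closedBall b (5 * (2:ℝ) ^ (-k b))) := measure_mono hsub
    _ ≤ ∑' b : u, volume (Metric.closedBall (b:ℝ) (5 * (2:ℝ) ^ (-k b))) :=
        measure_biUnion_le _ hcount _
    _ ≤ ∑' b : u, ENNReal.ofReal (10 / l) *
          ∫⁻ t in Metric.closedBall (b:ℝ) ((2:ℝ) ^ (-k b)), h t := by
        refine ENNReal.tsum_le_tsum fun b => ?_
        rw [Real.volume_closedBall]
        calc ENNReal.ofReal (2 * (5 * (2:ℝ) ^ (-k b)))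
            = ENNReal.ofReal 10 * ENNReal.ofReal ((2:ℝ) ^ (-k b)) := by
              rw [← ENNReal.ofReal_mul (by norm_num)]; congr 1; ring
          _ ≤ ENNReal.ofReal 10 * (ENNReal.ofReal (1 / l) *
                ∫⁻ t in Metric.closedBall (b:ℝ) ((2:ℝ) ^ (-k b)), h t) := by
              gcongr; exact hrad b (huT b.2)
          _ = _ := by
              rw [← mul_assoc, ← ENNReal.ofReal_mul (by norm_num)]; congr 2; ring
    _ = ENNReal.ofReal (10 / l) *
          ∫⁻ t in ⋃ b ∈ u, Metric.closedBall (b:ℝ) ((2:ℝ) ^ (-k b)), h t := by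
        rw [ENNReal.tsum_mul_left, lintegral_biUnion hcount
          (fun b _ => Metric.isClosed_closedBall.measurableSet) hdisj]
    _ ≤ _ := by
        gcongr
        exact Measure.restrict_le_self

theorem lintegral_Ioo_rpow {a b : ℝ} (ha : -1 < a) (hb : 0 ≤ b) :
    ∫⁻ t in Set.Ioo 0 b, ENNReal.ofReal (t ^ a) = ENNReal.ofReal (b ^ (a + 1) / (a + 1)) := by
  rw [← ofReal_integral_eq_lintegral_ofReal]
  · congr 1
    rw [← integral_Ioc_eq_integral_Ioo, ← intervalIntegral.integral_of_le hb,
      integral_rpow (Or.inl ha), Real.zero_rpow (by linarith)]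
    simp
  · have := (intervalIntegral.intervalIntegrable_rpow' (a := 0) (b := b) ha)
    rw [intervalIntegrable_iff_integrableOn_Ioo_of_le hb] at this
    exact this
  · filter_upwards [ae_restrict_mem measurableSet_Ioo] with t ht
    exact Real.rpow_nonneg ht.1.le _

/-- Strong type bound for the maximal function of a bounded function. -/
theorem lintegral_dyadicMax_rpow_le {s : ℝ} (hs : 1 < s) {h : ℝ → ℝ≥0∞} (hh : Measurable h)
    {B : ℝ≥0∞} (hB : B ≠ ∞) (hhB : ∀ x, h x ≤ B) :
    ∫⁻ x, dyadicMax h x ^ s ≤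
      ENNReal.ofReal (20 * s * 4 ^ (s - 1) / (s - 1)) * ∫⁻ x, h x ^ s := by
  have hs1 : 0 < s - 1 := by linarith
  have hMtop : ∀ x, dyadicMax h x ≠ ∞ := by
    intro x
    have h1 := dyadicMax_le_add h (g := fun _ => 0) (c := B) (by simpa using hhB) x
    have h2 : dyadicMax (fun _ => 0) x = 0 := by simp [dyadicMax]
    rw [h2, zero_add] at h1
    exact ne_top_of_le_ne_top (ENNReal.mul_ne_top (by simp) hB) h1
  have hhtop : ∀ x, h x ≠ ∞ := fun x => ne_top_of_le_ne_top hB (hhB x)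
  have hlevel : ∀ t : ℝ, 0 < t → volume {x | t < (dyadicMax h x).toReal} ≤
      ∫⁻ x, ENNReal.ofReal (20 / t) * {x | t < 4 * (h x).toReal}.indicator h x := by
    intro t ht
    have hsplit := dyadicMax_le_add h (g := {x | t < 4 * (h x).toReal}.indicator h)
      (c := ENNReal.ofReal (t / 4)) (by
        intro x
        by_cases hx : t < 4 * (h x).toReal
        · rw [Set.indicator_of_mem (by exact hx)]; exact le_self_add
        · rw [Set.indicator_of_notMem (by exact hx), zero_add]
          rw [ENNReal.le_ofReal_iff_toReal_le (hhtop x) (by positivity)]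
          linarith)
    have hm : Measurable ({x | t < 4 * (h x).toReal}.indicator h) :=
      hh.indicator (measurableSet_lt (by fun_prop) (by fun_prop))
    rw [lintegral_const_mul _ hm]
    have e : (20 / t) = 10 / (t / 2) := by field_simp; norm_num
    rw [e]
    refine (measure_mono ?_).trans (volume_lt_dyadicMax_le _ (half_pos ht))
    intro x hx
    have hx' : ENNReal.ofReal t < dyadicMax h x :=
      (ENNReal.ofReal_lt_iff_lt_toReal ht.le (hMtop x)).2 hx
    have h3 := hx'.trans_le (hsplit x)
    have h4 : ENNReal.ofReal t = ENNReal.ofReal (t / 2) + 2 * ENNReal.ofReal (t / 4) := by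
      rw [show (2:ℝ≥0∞) = ENNReal.ofReal 2 by simp, ← ENNReal.ofReal_mul (by norm_num),
        ← ENNReal.ofReal_add (by positivity) (by positivity)]
      congr 1; ring
    rw [h4] at h3
    exact lt_of_add_lt_add_right h3
  have e1 : ∀ x, dyadicMax h x ^ s = ENNReal.ofReal ((dyadicMax h x).toReal ^ s) := by
    intro x
    rw [← ENNReal.ofReal_rpow_of_nonneg ENNReal.toReal_nonneg (by linarith),
      ENNReal.ofReal_toReal (hMtop x)]
  simp only [e1]
  rw [lintegral_rpow_eq_lintegral_meas_lt_mul volume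
    (Filter.Eventually.of_forall fun x => ENNReal.toReal_nonneg)
    (measurable_dyadicMax hh).ennreal_toReal.aemeasurable (by linarith : 0 < s)]
  have step : ∫⁻ t in Set.Ioi (0:ℝ), volume {x | t < (dyadicMax h x).toReal} *
      ENNReal.ofReal (t ^ (s - 1)) ≤ ∫⁻ t in Set.Ioi (0:ℝ), ∫⁻ x,
        {p : ℝ × ℝ | p.1 < 4 * (h p.2).toReal}.indicator
          (fun p => ENNReal.ofReal (20 * p.1 ^ (s - 2)) * h p.2) (t, x) := by
    refine setLIntegral_mono' measurableSet_Ioi fun t (ht : 0 < t) => ?_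
    calc volume {x | t < (dyadicMax h x).toReal} * ENNReal.ofReal (t ^ (s - 1))
        ≤ (∫⁻ x, ENNReal.ofReal (20 / t) * {x | t < 4 * (h x).toReal}.indicator h x) *
            ENNReal.ofReal (t ^ (s - 1)) := by gcongr; exact hlevel t ht
      _ = ∫⁻ x, ENNReal.ofReal (20 / t) * {x | t < 4 * (h x).toReal}.indicator h x *
            ENNReal.ofReal (t ^ (s - 1)) := by
          rw [lintegral_mul_const']; exact ENNReal.ofReal_ne_top
      _ = _ := by
          refine lintegral_congr fun x => ?_
          by_cases hx : t < 4 * (h x).toReal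
          · rw [Set.indicator_of_mem (by exact hx), Set.indicator_of_mem (by exact hx)]
            rw [mul_right_comm, ← ENNReal.ofReal_mul (by positivity)]
            congr 2
            rw [show s - 1 = (s - 2) + 1 by ring, Real.rpow_add_one ht.ne']
            field_simp
          · rw [Set.indicator_of_notMem (by exact hx), Set.indicator_of_notMem (by exact hx)]
            simp
  have hmeas : Measurable ({p : ℝ × ℝ | p.1 < 4 * (h p.2).toReal}.indicator
          (fun p => ENNReal.ofReal (20 * p.1 ^ (s - 2)) * h p.2)) := by
    refine Measurable.indicator (by fun_prop) ?_
    exact measurableSet_lt (by fun_prop) (by fun_prop)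
  calc ENNReal.ofReal s * ∫⁻ t in Set.Ioi (0:ℝ), volume {x | t < (dyadicMax h x).toReal} *
        ENNReal.ofReal (t ^ (s - 1))
      ≤ ENNReal.ofReal s * ∫⁻ t in Set.Ioi (0:ℝ), ∫⁻ x,
        {p : ℝ × ℝ | p.1 < 4 * (h p.2).toReal}.indicator
          (fun p => ENNReal.ofReal (20 * p.1 ^ (s - 2)) * h p.2) (t, x) := by gcongr
    _ = ENNReal.ofReal s * ∫⁻ x, ∫⁻ t in Set.Ioi (0:ℝ),
        {p : ℝ × ℝ | p.1 < 4 * (h p.2).toReal}.indicator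
          (fun p => ENNReal.ofReal (20 * p.1 ^ (s - 2)) * h p.2) (t, x) := by
        rw [lintegral_lintegral_swap (f := fun t x => {p : ℝ × ℝ | p.1 < 4 * (h p.2).toReal}.indicator
          (fun p => ENNReal.ofReal (20 * p.1 ^ (s - 2)) * h p.2) (t, x)) hmeas.aemeasurable]
    _ = ENNReal.ofReal s * ∫⁻ x, ENNReal.ofReal (20 * 4 ^ (s - 1) / (s - 1)) * h x ^ s := by
        congr 1
        refine lintegral_congr fun x => ?_
        have e2 : ∀ t, {p : ℝ × ℝ | p.1 < 4 * (h p.2).toReal}.indicator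
            (fun p => ENNReal.ofReal (20 * p.1 ^ (s - 2)) * h p.2) (t, x) =
            (Set.Iio (4 * (h x).toReal)).indicator
              (fun t => ENNReal.ofReal (20 * t ^ (s - 2)) * h x) t := fun t => rfl
        simp only [e2]
        rw [lintegral_indicator measurableSet_Iio, Measure.restrict_restrict measurableSet_Iio,
          Set.inter_comm, Set.Ioi_inter_Iio, lintegral_mul_const' _ _ (hhtop x)]
        have e3 : ∀ t : ℝ, ENNReal.ofReal (20 * t ^ (s - 2)) =
            ENNReal.ofReal 20 * ENNReal.ofReal (t ^ (s - 2)) := fun t =>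
          ENNReal.ofReal_mul (by norm_num)
        simp only [e3]
        rw [lintegral_const_mul' _ _ ENNReal.ofReal_ne_top,
          lintegral_Ioo_rpow (by linarith) (by positivity),
          ← ENNReal.ofReal_mul (by norm_num)]
        obtain ⟨y, hy⟩ : ∃ y : NNReal, h x = y := ⟨_, (ENNReal.coe_toNNReal (hhtop x)).symm⟩
        rw [hy, ENNReal.coe_toReal, ← ENNReal.coe_rpow_of_nonneg _ (by linarith)]
        rw [← ENNReal.ofReal_coe_nnreal, ← ENNReal.ofReal_coe_nnreal,
          ← ENNReal.ofReal_mul (by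
            have : (0:ℝ) ≤ (4 * (y:ℝ)) ^ (s - 2 + 1) := by positivity
            have : 0 < s - 2 + 1 := by linarith
            positivity), ← ENNReal.ofReal_mul (by positivity)]
        congr 1
        rw [show s - 2 + 1 = s - 1 by ring, Real.mul_rpow (by norm_num) (NNReal.coe_nonneg y),
          NNReal.coe_rpow]
        rcases eq_or_ne y 0 with rfl | hy0
        · simp [Real.zero_rpow (by linarith : s ≠ 0)]
        · have : (y:ℝ) ^ s = (y:ℝ) ^ (s - 1) * y := by
            rw [← Real.rpow_add_one (by exact_mod_cast hy0)]; congr 1; ring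
          rw [this]; ring
    _ = _ := by
        rw [lintegral_const_mul' _ _ ENNReal.ofReal_ne_top, ← mul_assoc,
          ← ENNReal.ofReal_mul (by linarith)]
        congr 2; ring

/-- The standard averaging kernel at scale `2 ^ (-k)`. -/
def wt (k : ℕ) (x : ℝ) : ℝ≥0∞ := ENNReal.ofReal ((2:ℝ) ^ k / (1 + 2 ^ k * |x|) ^ 2)

/-- Convolution with the standard averaging kernel. -/
def avg (k : ℕ) (F : ℝ → ℝ≥0∞) (x : ℝ) : ℝ≥0∞ := ∫⁻ t, wt k (x - t) * F t

@[fun_prop]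
theorem measurable_wt (k : ℕ) : Measurable (wt k) := by
  unfold wt; fun_prop

theorem wt_neg (k : ℕ) (x : ℝ) : wt k (-x) = wt k x := by simp [wt]

theorem wt_sub_comm (k : ℕ) (x y : ℝ) : wt k (x - y) = wt k (y - x) := by
  rw [← wt_neg, neg_sub]

theorem wt_le_four_mul {k : ℕ} {x y : ℝ} (h : 2 ^ k * |x - y| ≤ 1) (t : ℝ) :
    wt k (x - t) ≤ 4 * wt k (y - t) := by
  unfold wt
  rw [show (4:ℝ≥0∞) = ENNReal.ofReal 4 by simp, ← ENNReal.ofReal_mul (by norm_num)]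
  apply ENNReal.ofReal_le_ofReal
  rw [← mul_div_assoc, div_le_div_iff₀ (by positivity) (by positivity)]
  have h1 : |y - t| ≤ |x - y| + |x - t| := by
    rw [show y - t = (x - t) - (x - y) by ring]
    exact (abs_sub _ _).trans (by linarith)
  have h2 : (1 + 2 ^ k * |y - t|) ≤ 2 * (1 + 2 ^ k * |x - t|) := by
    have h3 : (2:ℝ) ^ k * |y - t| ≤ 2 ^ k * (|x - y| + |x - t|) := by gcongr
    have : (0:ℝ) ≤ 2 ^ k * |x - t| := by positivity
    linarith
  have h4 : (1 + 2 ^ k * |y - t|) ^ 2 ≤ (2 * (1 + 2 ^ k * |x - t|)) ^ 2 := by gcongr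
  nlinarith [show (0:ℝ) < 2 ^ k by positivity]

@[fun_prop]
theorem measurable_avg (k : ℕ) {F : ℝ → ℝ≥0∞} (hF : Measurable F) : Measurable (avg k F) := by
  unfold avg
  exact Measurable.lintegral_prod_right' (f := fun p : ℝ × ℝ => wt k (p.1 - p.2) * F p.2)
    (by fun_prop)

theorem avg_tsum {ι : Type*} [Countable ι] (k : ℕ) {F : ι → ℝ → ℝ≥0∞}
    (hF : ∀ i, Measurable (F i)) (x : ℝ) :
    avg k (fun t => ∑' i, F i t) x = ∑' i, avg k (F i) x := by
  unfold avg
  simp only [← ENNReal.tsum_mul_left]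
  exact lintegral_tsum fun i => by fun_prop

theorem avg_const_mul (k : ℕ) (c : ℝ≥0∞) {F : ℝ → ℝ≥0∞} (hF : Measurable F) (x : ℝ) :
    avg k (fun t => c * F t) x = c * avg k F x := by
  unfold avg
  simp only [mul_left_comm _ c]
  exact lintegral_const_mul _ (by fun_prop)

theorem avg_le_four_mul {k : ℕ} {x y : ℝ} (h : 2 ^ k * |x - y| ≤ 1) (F : ℝ → ℝ≥0∞) :
    avg k F x ≤ 4 * avg k F y := by
  unfold avg
  rw [← lintegral_const_mul' _ _ (by simp)]
  refine lintegral_mono fun t => ?_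
  rw [← mul_assoc]
  gcongr
  exact wt_le_four_mul h t

theorem wt_le_tsum (k : ℕ) (x t : ℝ) :
    wt k (x - t) ≤ ∑' l : ℕ, 4 * (2:ℝ≥0∞)⁻¹ ^ l * (ENNReal.ofReal ((2:ℝ) ^ ((k:ℤ) - l)) *
      (Metric.closedBall x ((2:ℝ) ^ (-((k:ℤ) - l)))).indicator 1 t) := by
  have hex : ∃ l : ℕ, 2 ^ k * |x - t| ≤ 2 ^ l :=
    (pow_unbounded_of_one_lt _ (by norm_num : (1:ℝ) < 2)).imp fun _ h => h.le
  classical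
  set l := Nat.find hex with hl
  have h1 : 2 ^ k * |x - t| ≤ 2 ^ l := Nat.find_spec hex
  refine le_trans ?_ (ENNReal.le_tsum l)
  have hk : (0:ℝ) < 2 ^ k := by positivity
  have hlp : (0:ℝ) < 2 ^ l := by positivity
  rw [Set.indicator_of_mem]
  · have e : (4:ℝ≥0∞) * 2⁻¹ ^ l * (ENNReal.ofReal ((2:ℝ) ^ ((k:ℤ) - l)) *
        (1 : ℝ → ℝ≥0∞) t) = ENNReal.ofReal (4 * 2⁻¹ ^ l * (2:ℝ) ^ ((k:ℤ) - l)) := by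
      rw [ENNReal.ofReal_mul (by positivity), ENNReal.ofReal_mul (by positivity),
        ENNReal.ofReal_pow (by positivity), ENNReal.ofReal_inv_of_pos (by norm_num)]
      simp
    rw [e]
    unfold wt
    apply ENNReal.ofReal_le_ofReal
    rw [zpow_sub₀ (by norm_num), zpow_natCast, zpow_natCast]
    rw [div_le_iff₀ (by positivity)]
    have h3 : (2:ℝ) ^ l ≤ 2 * (1 + 2 ^ k * |x - t|) := by
      have hnn : 0 ≤ 2 ^ k * |x - t| := by positivity
      rcases Nat.eq_zero_or_pos l with h0 | h0
      · rw [h0]; simp; linarith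
      · have := Nat.find_min hex (m := l - 1) (by omega)
        rw [not_le] at this
        obtain ⟨m, hm⟩ : ∃ m, l = m + 1 := ⟨l - 1, by omega⟩
        rw [hm] at this ⊢
        simp only [Nat.add_sub_cancel] at this
        rw [pow_succ]; linarith
    have h4 : ((2:ℝ) ^ l) ^ 2 ≤ (2 * (1 + 2 ^ k * |x - t|)) ^ 2 := by gcongr
    have e2 : (4:ℝ) * 2⁻¹ ^ l * (2 ^ k / 2 ^ l) * (1 + 2 ^ k * |x - t|) ^ 2 =
        2 ^ k * ((2 * (1 + 2 ^ k * |x - t|)) ^ 2 / (2 ^ l) ^ 2) := by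
      rw [inv_pow]; field_simp; ring
    rw [e2]
    refine le_mul_of_one_le_right hk.le ?_
    rw [one_le_div (by positivity)]; exact h4
  · rw [Metric.mem_closedBall, dist_comm, Real.dist_eq, neg_sub, zpow_sub₀ (by norm_num),
      zpow_natCast, zpow_natCast, le_div_iff₀ hk, mul_comm]
    exact h1

theorem avg_le_dyadicMax (k : ℕ) {h : ℝ → ℝ≥0∞} (hh : Measurable h) (x : ℝ) :
    avg k h x ≤ 8 * dyadicMax h x := by
  calc avg k h x ≤ ∫⁻ t, ∑' l : ℕ, 4 * (2:ℝ≥0∞)⁻¹ ^ l * (ENNReal.ofReal ((2:ℝ) ^ ((k:ℤ) - l)) *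
      (Metric.closedBall x ((2:ℝ) ^ (-((k:ℤ) - l)))).indicator h t) := by
        refine lintegral_mono fun t => ?_
        refine (mul_le_mul_left (wt_le_tsum k x t) (h t)).trans (le_of_eq ?_)
        rw [← ENNReal.tsum_mul_right]
        refine tsum_congr fun l => ?_
        by_cases ht : t ∈ Metric.closedBall x ((2:ℝ) ^ (-((k:ℤ) - l)))
        · simp only [Set.indicator_of_mem ht]; simp; ring
        · simp only [Set.indicator_of_notMem ht]; simp
    _ = ∑' l : ℕ, 4 * (2:ℝ≥0∞)⁻¹ ^ l * (ENNReal.ofReal ((2:ℝ) ^ ((k:ℤ) - l)) *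
      ∫⁻ t in Metric.closedBall x ((2:ℝ) ^ (-((k:ℤ) - l))), h t) := by
        have hm : ∀ l : ℕ,
            Measurable ((Metric.closedBall x ((2:ℝ) ^ (-((k:ℤ) - l)))).indicator h) :=
          fun l => hh.indicator Metric.isClosed_closedBall.measurableSet
        rw [lintegral_tsum fun l => by
          exact (((hm l).const_mul _).const_mul _).aemeasurable]
        refine tsum_congr fun l => ?_
        rw [lintegral_const_mul _ ((hm l).const_mul _), lintegral_const_mul _ (hm l),
          lintegral_indicator Metric.isClosed_closedBall.measurableSet]
    _ ≤ ∑' l : ℕ, 4 * (2:ℝ≥0∞)⁻¹ ^ l * dyadicMax h x := by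
        refine ENNReal.tsum_le_tsum fun l => ?_
        gcongr
        exact le_iSup (fun k : ℤ => ENNReal.ofReal ((2:ℝ) ^ k) *
            ∫⁻ t in Metric.closedBall x ((2:ℝ) ^ (-k)), h t) ((k:ℤ) - l)
    _ = _ := by
        rw [ENNReal.tsum_mul_right, ENNReal.tsum_mul_left, ENNReal.tsum_geometric,
          ENNReal.one_sub_inv_two, inv_inv]
        norm_num

theorem lintegral_wt_sub_le (k : ℕ) (x : ℝ) : ∫⁻ t, wt k (x - t) ≤ 16 := by
  have h1 := avg_le_dyadicMax k (h := fun _ => 1) measurable_const x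
  have h2 := dyadicMax_le_add (fun _ => 1) (g := fun _ => 0) (c := 1) (by simp) x
  have h3 : dyadicMax (fun _ => 0) x = 0 := by simp [dyadicMax]
  rw [h3, zero_add, mul_one] at h2
  simp only [avg, mul_one] at h1
  refine h1.trans ?_
  calc 8 * dyadicMax (fun _ => 1) x ≤ 8 * 2 := by gcongr
    _ = 16 := by norm_num

theorem avg_rpow_le (k : ℕ) {F : ℝ → ℝ≥0∞} (hF : Measurable F) {q : ℝ} (hq : 1 < q) (x : ℝ) :
    avg k F x ^ q ≤ 16 ^ (q - 1) * avg k (fun t => F t ^ q) x := by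
  unfold avg
  refine (rpow_lintegral_mul_le volume (by fun_prop) hF.aemeasurable hq).trans ?_
  gcongr
  exact lintegral_wt_sub_le k x

theorem lintegral_avg_mul (k : ℕ) {F h : ℝ → ℝ≥0∞} (hF : Measurable F) (hh : Measurable h) :
    ∫⁻ x, avg k F x * h x = ∫⁻ x, F x * avg k h x := by
  unfold avg
  calc ∫⁻ x, (∫⁻ t, wt k (x - t) * F t) * h x
      = ∫⁻ x, ∫⁻ t, wt k (x - t) * F t * h x := by
        refine lintegral_congr fun x => ?_
        rw [lintegral_mul_const _ (by fun_prop)]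
    _ = ∫⁻ t, ∫⁻ x, wt k (x - t) * F t * h x := by
        rw [lintegral_lintegral_swap]
        simp only [Function.uncurry_def]
        fun_prop
    _ = _ := by
        refine lintegral_congr fun t => ?_
        rw [← lintegral_const_mul _ (by fun_prop)]
        refine lintegral_congr fun x => ?_
        rw [wt_sub_comm]; ring

theorem lintegral_avg_le (k : ℕ) {F : ℝ → ℝ≥0∞} (hF : Measurable F) :
    ∫⁻ x, avg k F x ≤ 16 * ∫⁻ x, F x := by
  have h := lintegral_avg_mul k hF (h := fun _ => 1) measurable_const
  simp only [mul_one] at h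
  rw [h, ← lintegral_const_mul _ hF]
  refine lintegral_mono fun x => ?_
  rw [mul_comm]
  gcongr
  simpa [avg] using lintegral_wt_sub_le k x

theorem ENNReal_rpow_le_of_le_mul_rpow {y A : ℝ≥0∞} {r s : ℝ} (hrs : r.HolderConjugate s)
    (hy : y ≠ ∞) (h : y ≤ A * y ^ (1 / s)) : y ≤ A ^ r := by
  rcases eq_or_ne y 0 with rfl | hy0
  · simp
  have hr := hrs.pos
  have h1 : y ^ (1 / r) * y ^ (1 / s) = y := by
    rw [← ENNReal.rpow_add _ _ hy0 hy, one_div, one_div, hrs.inv_add_inv_eq_one, ENNReal.rpow_one]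
  have hz0 : y ^ (1 / s) ≠ 0 := by
    simp [ENNReal.rpow_eq_zero_iff, hy0, hy]
  have hzt : y ^ (1 / s) ≠ ∞ := ENNReal.rpow_ne_top_of_nonneg (by
    have := hrs.symm.pos; positivity) hy
  have h2 : y ^ (1 / r) ≤ A := by
    rw [← ENNReal.mul_le_mul_iff_left hz0 hzt, h1]; exact h
  calc y = (y ^ (1 / r)) ^ r := by
        rw [← ENNReal.rpow_mul, one_div_mul_cancel hr.ne', ENNReal.rpow_one]
    _ ≤ A ^ r := ENNReal.rpow_le_rpow h2 hr.le

/-- The averages of a sequence of nonnegative functions, at a different scale for each member, sum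
up in `L^r` for `1 < r`. -/
theorem lintegral_tsum_avg_rpow_le {r : ℝ} (hr : 1 < r) : ∃ C : NNReal, ∀ F : ℕ → ℝ → ℝ≥0∞,
    (∀ j, Measurable (F j)) →
    ∫⁻ x, (∑' j, avg j (F j) x) ^ r ≤ C * ∫⁻ x, (∑' j, F j x) ^ r := by
  set s := r / (r - 1) with hs
  have hrs : r.HolderConjugate s := Real.HolderConjugate.conjExponent hr
  have hs1 : 1 < s := hrs.symm.lt
  have hr0 : 0 < r := hrs.pos
  have hs0 : 0 < s := hrs.symm.pos
  set C₀ := (20 * s * 4 ^ (s - 1) / (s - 1)).toNNReal with hC₀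
  refine ⟨(8 * C₀ ^ (1 / s)) ^ r, fun F hF => ?_⟩
  set S : ℝ → ℝ≥0∞ := fun x => ∑' j, avg j (F j) x with hS
  have hSm : Measurable S := Measurable.tsum fun j => measurable_avg j (hF j)
  set Sn : ℕ → ℝ → ℝ≥0∞ := fun n => (Set.Icc (-(n:ℝ)) n).indicator (fun x => min (S x) n) with hSn
  have hSnm : ∀ n, Measurable (Sn n) := fun n =>
    (hSm.min measurable_const).indicator measurableSet_Icc
  have hSnle : ∀ n x, Sn n x ≤ n := fun n x =>
    Set.indicator_le_self' (fun _ _ => zero_le) x |>.trans (min_le_right _ _)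
  have hSnS : ∀ n x, Sn n x ≤ S x := fun n x =>
    Set.indicator_le_self' (fun _ _ => zero_le) x |>.trans (min_le_left _ _)
  have hfin : ∀ n, ∫⁻ x, Sn n x ^ r ≠ ∞ := by
    intro n
    have : ∀ x, Sn n x ^ r ≤ (Set.Icc (-(n:ℝ)) n).indicator (fun _ => (n:ℝ≥0∞) ^ r) x := by
      intro x
      by_cases hx : x ∈ Set.Icc (-(n:ℝ)) n
      · rw [Set.indicator_of_mem hx]; exact ENNReal.rpow_le_rpow (hSnle n x) hr0.le
      · simp [hSn, Set.indicator_of_notMem hx, hr0]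
    refine ne_top_of_le_ne_top ?_ (lintegral_mono this)
    rw [lintegral_indicator measurableSet_Icc, setLIntegral_const]
    exact ENNReal.mul_ne_top (ENNReal.rpow_ne_top_of_nonneg hr0.le (by simp)) (by simp)
  have hbound : ∀ n, ∫⁻ x, Sn n x ^ r ≤
      (((8 * C₀ ^ (1 / s)) ^ r : NNReal) : ℝ≥0∞) * ∫⁻ x, (∑' j, F j x) ^ r := by
    intro n
    set h : ℝ → ℝ≥0∞ := fun x => Sn n x ^ (r - 1) with hh
    have hhm : Measurable h := (hSnm n).pow_const _
    have hhs : ∀ x, h x ^ s = Sn n x ^ r := by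
      intro x
      rw [hh, ← ENNReal.rpow_mul, hs, mul_div_cancel₀ _ (by linarith : r - 1 ≠ 0)]
    have hmax := lintegral_dyadicMax_rpow_le hs1 hhm (B := (n:ℝ≥0∞) ^ (r - 1))
      (ENNReal.rpow_ne_top_of_nonneg (by linarith) (by simp))
      (fun x => ENNReal.rpow_le_rpow (hSnle n x) (by linarith))
    simp only [hhs] at hmax
    have main : ∫⁻ x, Sn n x ^ r ≤ (8 * C₀ ^ (1 / s) * (∫⁻ x, (∑' j, F j x) ^ r) ^ (1 / r)) *
        (∫⁻ x, Sn n x ^ r) ^ (1 / s) := by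
      calc ∫⁻ x, Sn n x ^ r ≤ ∫⁻ x, S x * h x := by
            refine lintegral_mono fun x => ?_
            have : Sn n x ^ r = Sn n x * h x := by
              have e : Sn n x * h x = Sn n x ^ (1:ℝ) * Sn n x ^ (r - 1) := by
                rw [ENNReal.rpow_one]
              rw [e, ← ENNReal.rpow_add_of_nonneg _ _ (by norm_num) (by linarith)]
              congr 1; ring
            rw [this]
            gcongr
            exact hSnS n x
        _ = ∑' j, ∫⁻ x, avg j (F j) x * h x := by
            rw [← lintegral_tsum fun j => by
              exact ((measurable_avg j (hF j)).mul hhm).aemeasurable]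
            refine lintegral_congr fun x => ?_
            rw [ENNReal.tsum_mul_right]
        _ ≤ ∑' j, ∫⁻ x, F j x * (8 * dyadicMax h x) := by
            refine ENNReal.tsum_le_tsum fun j => ?_
            rw [lintegral_avg_mul j (hF j) hhm]
            gcongr with x
            exact avg_le_dyadicMax j hhm x
        _ = 8 * ∫⁻ x, ((fun x => ∑' j, F j x) * dyadicMax h) x := by
            rw [← lintegral_tsum fun j => by
              exact ((hF j).mul ((measurable_dyadicMax hhm).const_mul _)).aemeasurable,
              ← lintegral_const_mul _
                ((Measurable.tsum hF).mul (measurable_dyadicMax hhm))]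
            refine lintegral_congr fun x => ?_
            rw [ENNReal.tsum_mul_right, Pi.mul_apply]; ring
        _ ≤ 8 * ((∫⁻ x, (∑' j, F j x) ^ r) ^ (1 / r) *
              (∫⁻ x, dyadicMax h x ^ s) ^ (1 / s)) := by
            gcongr
            exact ENNReal.lintegral_mul_le_Lp_mul_Lq volume hrs
              (Measurable.tsum hF).aemeasurable (measurable_dyadicMax hhm).aemeasurable
        _ ≤ 8 * ((∫⁻ x, (∑' j, F j x) ^ r) ^ (1 / r) *
              (C₀ * ∫⁻ x, Sn n x ^ r) ^ (1 / s)) := by gcongr; exact hmax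
        _ = _ := by
            rw [ENNReal.mul_rpow_of_nonneg _ _ (by positivity)]; ring
    refine (ENNReal_rpow_le_of_le_mul_rpow hrs (hfin n) main).trans (le_of_eq ?_)
    rw [ENNReal.mul_rpow_of_nonneg _ _ hr0.le, ← ENNReal.rpow_mul, one_div_mul_cancel hr0.ne',
      ENNReal.rpow_one, ENNReal.coe_rpow_of_nonneg _ hr0.le, ENNReal.coe_mul,
      ENNReal.coe_rpow_of_nonneg _ (by positivity)]
    rfl
  have hlim : ∀ x, Filter.Tendsto (fun n => Sn n x ^ r) Filter.atTop (nhds (S x ^ r)) := by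
    intro x
    refine (ENNReal.continuous_rpow_const.tendsto _).comp ?_
    have h1 : Filter.Tendsto (fun n : ℕ => min (S x) (n:ℝ≥0∞)) Filter.atTop
        (nhds (min (S x) ∞)) := tendsto_const_nhds.min ENNReal.tendsto_nat_nhds_top
    rw [min_eq_left le_top] at h1
    refine h1.congr' ?_
    obtain ⟨N, hN⟩ := exists_nat_ge |x|
    filter_upwards [Filter.eventually_ge_atTop N] with n hn
    have : x ∈ Set.Icc (-(n:ℝ)) n := by
      rw [Set.mem_Icc, ← abs_le]; exact hN.trans (by exact_mod_cast hn)
    simp only [hSn, Set.indicator_of_mem this]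
  calc ∫⁻ x, S x ^ r = ∫⁻ x, Filter.liminf (fun n => Sn n x ^ r) Filter.atTop := by
        refine lintegral_congr fun x => ?_
        rw [(hlim x).liminf_eq]
    _ ≤ Filter.liminf (fun n => ∫⁻ x, Sn n x ^ r) Filter.atTop :=
        lintegral_liminf_le fun n => (hSnm n).pow_const _
    _ ≤ _ := by
        refine Filter.liminf_le_of_le (by isBoundedDefault) fun b hb => ?_
        obtain ⟨n, hn⟩ := hb.exists
        exact hn.trans (hbound n)

open scoped SchwartzMap

/-- The `L¹`-normalized dilation of a Schwartz function by `2 ^ k`. -/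
def dil (k : ℕ) (Φ : 𝓢(ℝ, ℂ)) : 𝓢(ℝ, ℂ) :=
  (2:ℂ) ^ k • SchwartzMap.compCLMOfContinuousLinearEquiv ℂ
    (ContinuousLinearEquiv.unitsEquivAut ℝ (Units.mk0 ((2:ℝ) ^ k) (by positivity))) Φ

theorem dil_apply (k : ℕ) (Φ : 𝓢(ℝ, ℂ)) (x : ℝ) : dil k Φ x = (2:ℂ) ^ k * Φ (2 ^ k * x) := by
  simp [dil, mul_comm x]

theorem fourier_dil (k : ℕ) (Φ : 𝓢(ℝ, ℂ)) (ξ : ℝ) : 𝓕 (dil k Φ) ξ = 𝓕 Φ (((2:ℝ) ^ k)⁻¹ * ξ) := by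
  simp only [SchwartzMap.fourier_coe]
  rw [Real.fourier_real_eq_integral_exp_smul, Real.fourier_real_eq_integral_exp_smul]
  have h := Measure.integral_comp_mul_left
    (fun v => Complex.exp (↑(-2 * π * v * (((2:ℝ) ^ k)⁻¹ * ξ)) * Complex.I) • Φ v) ((2:ℝ) ^ k)
  have h2 : |((2:ℝ) ^ k)⁻¹| = ((2:ℝ) ^ k)⁻¹ := abs_of_pos (by positivity)
  rw [h2] at h
  have h3 : (∫ v, Complex.exp (↑(-2 * π * v * (((2:ℝ) ^ k)⁻¹ * ξ)) * Complex.I) • Φ v)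
      = (2:ℂ) ^ k * ∫ x, Complex.exp (↑(-2 * π * ((2:ℝ) ^ k * x) * (((2:ℝ) ^ k)⁻¹ * ξ)) *
        Complex.I) • Φ (2 ^ k * x) := by
    rw [h, Complex.real_smul, ← mul_assoc]
    push_cast
    rw [mul_inv_cancel₀ (pow_ne_zero _ two_ne_zero), one_mul]
  rw [h3, ← integral_const_mul]
  congr 1; ext x
  rw [dil_apply, show -2 * π * ((2:ℝ) ^ k * x) * (((2:ℝ) ^ k)⁻¹ * ξ) = -2 * π * x * ξ by
    field_simp]
  simp only [smul_eq_mul]; ring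

theorem exists_norm_le_div (Φ : 𝓢(ℝ, ℂ)) :
    ∃ C : ℝ, 0 ≤ C ∧ ∀ x, ‖Φ x‖ ≤ C / (1 + |x|) ^ 2 := by
  refine ⟨2 ^ 2 * (Finset.Iic ((2, 0) : ℕ × ℕ)).sup (fun m => SchwartzMap.seminorm ℂ m.1 m.2) Φ,
    by positivity, fun x => ?_⟩
  have h := SchwartzMap.one_add_le_sup_seminorm_apply (𝕜 := ℂ) (m := (2, 0)) (k := 2) (n := 0)
    le_rfl le_rfl Φ x
  rw [le_div_iff₀ (by positivity), mul_comm]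
  simpa using h

theorem enorm_le_mul_wt {C : ℝ} (hC : 0 ≤ C) {k : ℕ} {x : ℝ} {z : ℂ}
    (h : ‖z‖ ≤ 2 ^ k * (C / (1 + |2 ^ k * x|) ^ 2)) : ‖z‖ₑ ≤ C.toNNReal * wt k x := by
  rw [← ofReal_norm, wt, show ((C.toNNReal : NNReal) : ℝ≥0∞) = ENNReal.ofReal C from rfl,
    ← ENNReal.ofReal_mul hC]
  refine ENNReal.ofReal_le_ofReal (h.trans_eq ?_)
  rw [abs_mul, abs_of_pos (show (0:ℝ) < 2 ^ k by positivity)]; ring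

theorem exists_enorm_dil_le (Φ : 𝓢(ℝ, ℂ)) :
    ∃ C : NNReal, ∀ k x, ‖dil k Φ x‖ₑ ≤ C * wt k x := by
  obtain ⟨C, hC, h⟩ := exists_norm_le_div Φ
  refine ⟨C.toNNReal, fun k x => enorm_le_mul_wt hC ?_⟩
  rw [dil_apply, norm_mul]
  simpa using h (2 ^ k * x)

theorem exists_enorm_dil_sub_le (Φ : 𝓢(ℝ, ℂ)) :
    ∃ C : NNReal, ∀ k x δ, 0 ≤ δ → 2 ^ k * δ ≤ 1 →
      ‖dil k Φ x - dil k Φ (x - δ)‖ₑ ≤ C * ENNReal.ofReal (2 ^ k * δ) * wt k x := by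
  obtain ⟨C, hC, h⟩ := exists_norm_le_div (SchwartzMap.derivCLM ℂ ℂ Φ)
  refine ⟨(4 * C).toNNReal, fun k x δ hδ hkδ => ?_⟩
  have hk : (0:ℝ) < 2 ^ k := by positivity
  set v := (2:ℝ) ^ k * x with hv
  have hle : ‖Φ v - Φ (v - 2 ^ k * δ)‖ ≤ 4 * C / (1 + |v|) ^ 2 * (2 ^ k * δ) := by
    have := Convex.norm_image_sub_le_of_norm_deriv_le (𝕜 := ℝ) (f := Φ)
      (s := Set.Icc (v - 2 ^ k * δ) v) (C := 4 * C / (1 + |v|) ^ 2) (x := v - 2 ^ k * δ) (y := v)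
      (fun y _ => Φ.differentiableAt) ?_ (convex_Icc _ _) ?_ ?_
    · refine this.trans_eq ?_
      rw [sub_sub_cancel, Real.norm_of_nonneg (by positivity)]
    · intro y hy
      refine (h y).trans ?_
      rw [div_le_div_iff₀ (by positivity) (by positivity)]
      have h1 : |v| ≤ |y| + 1 := by
        have : |v - y| ≤ 1 := by rw [abs_le]; constructor <;> linarith [hy.1, hy.2]
        have := abs_add_le (v - y) y
        rw [sub_add_cancel] at this; linarith
      have h2 : (1 + |v|) ^ 2 ≤ (2 * (1 + |y|)) ^ 2 := by
        gcongr; linarith [abs_nonneg y]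
      nlinarith
    · constructor <;> nlinarith
    · constructor <;> nlinarith
  have h3 : ‖dil k Φ x - dil k Φ (x - δ)‖ ≤
      2 ^ k * ((4 * C * (2 ^ k * δ)) / (1 + |2 ^ k * x|) ^ 2) := by
    rw [dil_apply, dil_apply, ← mul_sub, norm_mul, mul_sub]
    simp only [norm_pow, Complex.norm_ofNat]
    gcongr
    exact hle.trans_eq (by ring)
  refine (enorm_le_mul_wt (by positivity) h3).trans_eq ?_
  congr 1
  rw [show ((4 * C).toNNReal : ℝ≥0∞) = ENNReal.ofReal (4 * C) from rfl,
    ← ENNReal.ofReal_mul (by positivity)]; rfl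

/-- Convolution of Schwartz functions. -/
def sconv (f g : 𝓢(ℝ, ℂ)) : 𝓢(ℝ, ℂ) :=
  SchwartzMap.convolution (ContinuousLinearMap.mul ℂ ℂ) f g

theorem sconv_apply (f g : 𝓢(ℝ, ℂ)) (x : ℝ) : sconv f g x = conv f g x := by
  simp [sconv, SchwartzMap.convolution_apply, MeasureTheory.convolution, conv]

theorem fourier_sconv (f g : 𝓢(ℝ, ℂ)) (ξ : ℝ) : 𝓕 (sconv f g) ξ = 𝓕 f ξ * 𝓕 g ξ := by
  simp [sconv, SchwartzMap.fourier_convolution]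

theorem schwartz_ext_fourier {f g : 𝓢(ℝ, ℂ)} (h : ∀ ξ, 𝓕 f ξ = 𝓕 g ξ) : f = g := by
  have : 𝓕 f = 𝓕 g := by ext ξ; exact h ξ
  rw [← FourierTransform.fourierInv_fourier_eq (F := 𝓢(ℝ, ℂ)) f, this,
    FourierTransform.fourierInv_fourier_eq]

theorem sconv_sconv_dil {Φ Ψ : 𝓢(ℝ, ℂ)} (h : ∀ ξ, 𝓕 Φ ξ * 𝓕 Ψ ξ = 𝓕 Φ ξ) (k : ℕ)
    (f : 𝓢(ℝ, ℂ)) : sconv (sconv f (dil k Φ)) (dil k Ψ) = sconv f (dil k Φ) := by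
  apply schwartz_ext_fourier
  intro ξ
  simp only [fourier_sconv, fourier_dil, mul_assoc, h]

theorem exists_enorm_sconv_le_avg (Ψ : 𝓢(ℝ, ℂ)) :
    ∃ C : NNReal, ∀ k (g : 𝓢(ℝ, ℂ)) x, ‖sconv g (dil k Ψ) x‖ₑ ≤ C * avg k (fun t => ‖g t‖ₑ) x := by
  obtain ⟨C, hC⟩ := exists_enorm_dil_le Ψ
  refine ⟨C, fun k g x => ?_⟩
  rw [sconv_apply, conv]
  refine (enorm_integral_le_lintegral_enorm _).trans ?_
  rw [avg, ← lintegral_const_mul' _ _ (by simp)]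
  refine lintegral_mono fun t => ?_
  rw [enorm_mul, mul_comm, ← mul_assoc]
  gcongr
  exact hC k _

theorem fourier_derivCLM (f : 𝓢(ℝ, ℂ)) (ξ : ℝ) :
    𝓕 (SchwartzMap.derivCLM ℂ ℂ f) ξ = 2 * π * Complex.I * ξ * 𝓕 f ξ := by
  have hd : ⇑(SchwartzMap.derivCLM ℂ ℂ f) = deriv f := by ext; simp
  have h := congrFun (Real.fourier_deriv f.integrable f.differentiable
    (by rw [← hd]; exact SchwartzMap.integrable _)) ξ
  rw [SchwartzMap.fourier_coe, SchwartzMap.fourier_coe, hd, h, smul_eq_mul]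

theorem derivCLM_sconv_dil (g Θ : 𝓢(ℝ, ℂ)) (k : ℕ) :
    SchwartzMap.derivCLM ℂ ℂ (sconv g (dil k Θ)) =
      (2:ℂ) ^ k • sconv g (dil k (SchwartzMap.derivCLM ℂ ℂ Θ)) := by
  apply schwartz_ext_fourier
  intro ξ
  rw [FourierTransform.fourier_smul, smul_apply, fourier_derivCLM, fourier_sconv,
    fourier_sconv, fourier_dil, fourier_dil, fourier_derivCLM, smul_eq_mul]
  push_cast
  field_simp

/-- The point `2 ^ (-j) * μ`. -/
def dyadicPt (j : ℕ) (μ : ℝ) : ℝ := (2:ℝ) ^ (-(j:ℤ)) * μ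

/-- The dyadic interval supporting the Haar function with index `(j, μ)`. -/
def haarIco (j : ℕ) (μ : ℤ) : Set ℝ := Set.Ico (dyadicPt j μ) (dyadicPt j (μ + 1))

theorem haarFn_eq (j : ℕ) (μ : ℤ) (x : ℝ) : haarFn j μ x =
    (Set.Ico (dyadicPt j μ) (dyadicPt j (μ + 1 / 2))).indicator (fun _ => (1:ℂ)) x -
    (Set.Ico (dyadicPt j (μ + 1 / 2)) (dyadicPt j (μ + 1))).indicator (fun _ => (1:ℂ)) x := rfl

theorem dyadicPt_mono (j : ℕ) : Monotone (dyadicPt j) := fun a b h => by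
  unfold dyadicPt; gcongr

theorem two_zpow_neg_mul (j : ℕ) : (2:ℝ) ^ j * (2:ℝ) ^ (-(j:ℤ)) = 1 := by
  rw [zpow_neg, zpow_natCast]; exact mul_inv_cancel₀ (by positivity)

theorem measurableSet_haarIco (j : ℕ) (μ : ℤ) : MeasurableSet (haarIco j μ) := measurableSet_Ico

theorem volume_haarIco (j : ℕ) (μ : ℤ) : volume (haarIco j μ) = ENNReal.ofReal (2 ^ (-(j:ℤ))) := by
  rw [haarIco, Real.volume_Ico, dyadicPt, dyadicPt]; congr 1; ring

theorem measurable_haarFn (j : ℕ) (μ : ℤ) : Measurable (haarFn j μ) :=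
  (measurable_const.indicator measurableSet_Ico).sub (measurable_const.indicator measurableSet_Ico)

theorem enorm_haarFn_le (j : ℕ) (μ : ℤ) (x : ℝ) :
    ‖haarFn j μ x‖ₑ ≤ (haarIco j μ).indicator 1 x := by
  have h1 : dyadicPt j μ ≤ dyadicPt j (μ + 1 / 2) := dyadicPt_mono j (by linarith)
  have h2 : dyadicPt j (μ + 1 / 2) ≤ dyadicPt j (μ + 1) := dyadicPt_mono j (by linarith)
  rw [haarFn_eq, haarIco]
  by_cases hl : x ∈ Set.Ico (dyadicPt j μ) (dyadicPt j (μ + 1 / 2))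
  · have hr : x ∉ Set.Ico (dyadicPt j (μ + 1 / 2)) (dyadicPt j (μ + 1)) :=
      fun h => absurd hl.2 (not_lt.2 h.1)
    have hI : x ∈ Set.Ico (dyadicPt j μ) (dyadicPt j (μ + 1)) := ⟨hl.1, hl.2.trans_le h2⟩
    rw [Set.indicator_of_mem hl, Set.indicator_of_notMem hr, Set.indicator_of_mem hI]
    simp
  · by_cases hr : x ∈ Set.Ico (dyadicPt j (μ + 1 / 2)) (dyadicPt j (μ + 1))
    · have hI : x ∈ Set.Ico (dyadicPt j μ) (dyadicPt j (μ + 1)) := ⟨h1.trans hr.1, hr.2⟩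
      rw [Set.indicator_of_notMem hl, Set.indicator_of_mem hr, Set.indicator_of_mem hI]
      simp
    · rw [Set.indicator_of_notMem hl, Set.indicator_of_notMem hr]
      simp

theorem integral_mul_haarFn {g : ℝ → ℂ} (hg : Continuous g) (j : ℕ) (μ : ℤ) :
    ∫ y, g y * haarFn j μ y = (∫ y in (dyadicPt j μ)..(dyadicPt j (μ + 1 / 2)), g y) -
      ∫ y in (dyadicPt j (μ + 1 / 2))..(dyadicPt j (μ + 1)), g y := by
  have key (a b : ℝ) (hab : a ≤ b) :
      Integrable (fun y => g y * (Set.Ico a b).indicator (fun _ => (1:ℂ)) y) ∧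
      ∫ y, g y * (Set.Ico a b).indicator (fun _ => (1:ℂ)) y = ∫ y in a..b, g y := by
    have : (fun y => g y * (Set.Ico a b).indicator (fun _ => (1:ℂ)) y) =
        (Set.Ico a b).indicator g := by
      ext y; by_cases hy : y ∈ Set.Ico a b <;> simp [hy]
    rw [this]
    constructor
    · rw [integrable_indicator_iff measurableSet_Ico]
      exact (hg.integrableOn_Icc).mono_set Set.Ico_subset_Icc_self
    · rw [integral_indicator measurableSet_Ico, intervalIntegral.integral_of_le hab,
        integral_Ico_eq_integral_Ioc]
  obtain ⟨i1, e1⟩ := key _ _ (dyadicPt_mono j (show (μ:ℝ) ≤ μ + 1 / 2 by linarith))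
  obtain ⟨i2, e2⟩ := key _ _ (dyadicPt_mono j (show (μ:ℝ) + 1 / 2 ≤ μ + 1 by linarith))
  simp only [haarFn_eq, mul_sub]
  rw [integral_sub i1 i2, e1, e2]

theorem exists_enorm_conv_haarFn_le (Φ : 𝓢(ℝ, ℂ)) :
    ∃ C : NNReal, ∀ k j μ x, ‖conv (haarFn j μ) (dil k Φ) x‖ₑ ≤
      C * avg k ((haarIco j μ).indicator 1) x := by
  obtain ⟨C, hC⟩ := exists_enorm_dil_le Φ
  refine ⟨C, fun k j μ x => ?_⟩
  rw [conv]
  refine (enorm_integral_le_lintegral_enorm _).trans ?_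
  rw [avg, ← lintegral_const_mul' _ _ (by simp)]
  refine lintegral_mono fun t => ?_
  rw [enorm_mul, mul_comm, ← mul_assoc]
  gcongr
  · exact hC k _
  · exact enorm_haarFn_le j μ t

theorem exists_enorm_conv_haarFn_le_of_le (Φ : 𝓢(ℝ, ℂ)) :
    ∃ C : NNReal, ∀ k j μ x, k ≤ j → ‖conv (haarFn j μ) (dil k Φ) x‖ₑ ≤
      C * (2:ℝ≥0∞)⁻¹ ^ (j - k) * avg k ((haarIco j μ).indicator 1) x := by
  obtain ⟨C, hC⟩ := exists_enorm_dil_sub_le Φ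
  refine ⟨C, fun k j μ x hkj => ?_⟩
  set K := dil k Φ with hK
  set δ : ℝ := 2 ^ (-(j:ℤ)) / 2 with hδ
  have hδ0 : 0 < δ := by positivity
  have hkδ : 2 ^ k * δ ≤ (2:ℝ)⁻¹ ^ (j - k) := by
    have e : (2:ℝ) ^ k * 2 ^ (-(j:ℤ)) = (2:ℝ)⁻¹ ^ (j - k) := by
      obtain ⟨n, rfl⟩ := Nat.exists_eq_add_of_le hkj
      rw [Nat.add_sub_cancel_left, zpow_neg, zpow_natCast, pow_add, inv_pow]
      field_simp
    rw [hδ, ← mul_div_assoc, e]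
    have : (0:ℝ) < 2⁻¹ ^ (j - k) := by positivity
    linarith
  have hmid : dyadicPt j (μ + 1 / 2) = dyadicPt j μ + δ := by simp only [dyadicPt, hδ]; ring
  have hend : dyadicPt j (μ + 1) = dyadicPt j μ + δ + δ := by simp only [dyadicPt, hδ]; ring
  have e1 : conv (haarFn j μ) K x =
      ∫ t in (dyadicPt j μ)..(dyadicPt j μ + δ), (K (x - t) - K (x - t - δ)) := by
    have h0 := integral_mul_haarFn (g := fun t => K (x - t))
      (K.continuous.comp (by fun_prop)) j μ
    rw [conv]
    simp only [mul_comm (haarFn j μ _)]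
    rw [h0, hmid, hend, ← intervalIntegral.integral_comp_add_right (fun t => K (x - t)) δ,
      ← intervalIntegral.integral_sub]
    · simp only [sub_add_eq_sub_sub]
    · exact (K.continuous.comp (by fun_prop)).intervalIntegrable _ _
    · exact (K.continuous.comp (by fun_prop)).intervalIntegrable _ _
  rw [e1, intervalIntegral.integral_of_le (by linarith), ← integral_Ico_eq_integral_Ioc]
  refine (enorm_integral_le_lintegral_enorm _).trans ?_
  rw [avg, ← lintegral_const_mul' _ _ (by finiteness), ← lintegral_indicator measurableSet_Ico]
  refine lintegral_mono fun t => ?_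
  by_cases ht : t ∈ Set.Ico (dyadicPt j μ) (dyadicPt j μ + δ)
  · have hI : t ∈ haarIco j μ := ⟨ht.1, by rw [hend]; linarith [ht.2]⟩
    simp only [Set.indicator_of_mem ht, Set.indicator_of_mem hI, Pi.one_apply, mul_one]
    refine (hC k (x - t) δ hδ0.le (hkδ.trans (pow_le_one₀ (by norm_num) (by norm_num)))).trans ?_
    gcongr
    refine (ENNReal.ofReal_le_ofReal hkδ).trans_eq ?_
    rw [ENNReal.ofReal_pow (by norm_num), ENNReal.ofReal_inv_of_pos (by norm_num)]
    simp
  · simp [Set.indicator_of_notMem ht]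

/-- The Haar coefficient of `f` with index `(j, μ)`. -/
def hcoef (j : ℕ) (μ : ℤ) (f : ℝ → ℂ) : ℂ := (2:ℂ) ^ j * ∫ y, f y * haarFn j μ y

theorem exists_enorm_hcoef_le_avg (Ψ : 𝓢(ℝ, ℂ)) :
    ∃ C : NNReal, ∀ (k j : ℕ) (μ : ℤ) (g : 𝓢(ℝ, ℂ)), k ≤ j → sconv g (dil k Ψ) = g →
      ∀ x ∈ haarIco j μ, ‖hcoef j μ g‖ₑ ≤ C * avg k (fun t => ‖g t‖ₑ) x := by
  obtain ⟨C, hC⟩ := exists_enorm_sconv_le_avg Ψ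
  refine ⟨C * 4, fun k j μ g hkj hg x hx => ?_⟩
  have hpt (y : ℝ) : ‖g y * haarFn j μ y‖ₑ ≤
      (haarIco j μ).indicator (fun _ => C * (4 * avg k (fun t => ‖g t‖ₑ) x)) y := by
    rw [enorm_mul]
    refine (mul_le_mul_right (enorm_haarFn_le j μ y) _).trans ?_
    by_cases hy : y ∈ haarIco j μ
    · simp only [Set.indicator_of_mem hy, Pi.one_apply, mul_one]
      nth_rewrite 1 [← hg]
      refine (hC k g y).trans ?_
      gcongr
      apply avg_le_four_mul
      have h1 : |y - x| ≤ 2 ^ (-(j:ℤ)) := by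
        have e : dyadicPt j (μ + 1) = dyadicPt j μ + 2 ^ (-(j:ℤ)) := by simp only [dyadicPt]; ring
        have := hx.1; have := hx.2; have := hy.1; have := hy.2
        rw [abs_le]; constructor <;> linarith
      calc (2:ℝ) ^ k * |y - x| ≤ 2 ^ j * 2 ^ (-(j:ℤ)) := by gcongr; norm_num
        _ = 1 := two_zpow_neg_mul j
    · simp [Set.indicator_of_notMem hy]
  rw [hcoef, enorm_mul]
  calc ‖(2:ℂ) ^ j‖ₑ * ‖∫ y, g y * haarFn j μ y‖ₑ
      ≤ ‖(2:ℂ) ^ j‖ₑ * ∫⁻ y, (haarIco j μ).indicator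
          (fun _ => C * (4 * avg k (fun t => ‖g t‖ₑ) x)) y := by
        gcongr
        exact (enorm_integral_le_lintegral_enorm _).trans (lintegral_mono hpt)
    _ = (‖(2:ℂ) ^ j‖ₑ * ENNReal.ofReal (2 ^ (-(j:ℤ)))) *
          (C * (4 * avg k (fun t => ‖g t‖ₑ) x)) := by
        rw [lintegral_indicator (measurableSet_haarIco j μ), setLIntegral_const, volume_haarIco]
        ring
    _ = _ := by
        rw [← ofReal_norm, ← ENNReal.ofReal_mul (by positivity), norm_pow, Complex.norm_ofNat,
          two_zpow_neg_mul]
        push_cast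
        simp [mul_assoc]

theorem exists_enorm_hcoef_le_avg_endpoints (Θ : 𝓢(ℝ, ℂ)) :
    ∃ C : NNReal, ∀ (k j : ℕ) (μ : ℤ) (g : 𝓢(ℝ, ℂ)), j ≤ k →
      sconv g (dil k (SchwartzMap.derivCLM ℂ ℂ Θ)) = g →
      ‖hcoef j μ g‖ₑ ≤ C * (2:ℝ≥0∞)⁻¹ ^ (k - j) * (avg k (fun t => ‖g t‖ₑ) (dyadicPt j μ) +
        avg k (fun t => ‖g t‖ₑ) (dyadicPt j (μ + 1 / 2)) +
        avg k (fun t => ‖g t‖ₑ) (dyadicPt j (μ + 1))) := by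
  obtain ⟨C, hC⟩ := exists_enorm_sconv_le_avg Θ
  refine ⟨2 * C, fun k j μ g hjk hg => ?_⟩
  set U := sconv g (dil k Θ) with hU
  have hder (x : ℝ) : HasDerivAt (fun y => ((2:ℂ) ^ k)⁻¹ * U y) (g x) x := by
    have h1 := (U.differentiableAt (x := x)).hasDerivAt
    have h2 := congrArg (fun F : 𝓢(ℝ, ℂ) => F x) (derivCLM_sconv_dil g Θ k)
    simp only [← hU, hg, SchwartzMap.derivCLM_apply, smul_apply, smul_eq_mul] at h2
    rw [h2] at h1
    have h3 := h1.const_mul ((2:ℂ) ^ k)⁻¹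
    rwa [inv_mul_cancel_left₀ (pow_ne_zero _ two_ne_zero)] at h3
  have hinterval (a b : ℝ) : ∫ y in a..b, g y = ((2:ℂ) ^ k)⁻¹ * U b - ((2:ℂ) ^ k)⁻¹ * U a :=
    intervalIntegral.integral_eq_sub_of_hasDerivAt (fun x _ => hder x)
      (g.continuous.intervalIntegrable _ _)
  set a := dyadicPt j μ
  set b := dyadicPt j (μ + 1 / 2)
  set c := dyadicPt j (μ + 1)
  have e1 : hcoef j μ g = ((2:ℂ) ^ j * ((2:ℂ) ^ k)⁻¹) * (U b + U b - U a - U c) := by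
    rw [hcoef, integral_mul_haarFn g.continuous, hinterval, hinterval]; ring
  have e2 : ‖(2:ℂ) ^ j * ((2:ℂ) ^ k)⁻¹‖ₑ = (2:ℝ≥0∞)⁻¹ ^ (k - j) := by
    obtain ⟨n, rfl⟩ := Nat.exists_eq_add_of_le hjk
    have : (2:ℂ) ^ j * ((2:ℂ) ^ (j + n))⁻¹ = (2⁻¹) ^ n := by
      rw [pow_add, inv_pow]; field_simp
    rw [this, Nat.add_sub_cancel_left, ← ofReal_norm, norm_pow, ENNReal.ofReal_pow (by positivity),
      norm_inv, Complex.norm_ofNat, ENNReal.ofReal_inv_of_pos (by norm_num)]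
    simp
  rw [e1, enorm_mul, e2]
  have e3 : ‖U b + U b - U a - U c‖ₑ ≤ ‖U b‖ₑ + ‖U b‖ₑ + ‖U a‖ₑ + ‖U c‖ₑ :=
    (enorm_sub_le).trans (add_le_add_left ((enorm_sub_le).trans
      (add_le_add_left (enorm_add_le _ _) _)) _)
  calc (2:ℝ≥0∞)⁻¹ ^ (k - j) * ‖U b + U b - U a - U c‖ₑ
      ≤ (2:ℝ≥0∞)⁻¹ ^ (k - j) * (2 * ‖U a‖ₑ + 2 * ‖U b‖ₑ + 2 * ‖U c‖ₑ) := by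
        gcongr
        refine e3.trans ?_
        rw [two_mul, two_mul, two_mul]
        calc _ = ‖U a‖ₑ + (‖U b‖ₑ + ‖U b‖ₑ) + ‖U c‖ₑ := by ring
          _ ≤ _ := by gcongr <;> exact le_self_add
    _ ≤ (2:ℝ≥0∞)⁻¹ ^ (k - j) * (2 * (C * avg k (fun t => ‖g t‖ₑ) a) +
          2 * (C * avg k (fun t => ‖g t‖ₑ) b) + 2 * (C * avg k (fun t => ‖g t‖ₑ) c)) := by
        gcongr <;> exact hC k g _
    _ = _ := by push_cast; ring

theorem enorm_hcoef_le {g : ℝ → ℂ} {B : ℝ≥0∞} (hg : ∀ y, ‖g y‖ₑ ≤ B) (j : ℕ) (μ : ℤ) :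
    ‖hcoef j μ g‖ₑ ≤ B := by
  rw [hcoef, enorm_mul]
  calc ‖(2:ℂ) ^ j‖ₑ * ‖∫ y, g y * haarFn j μ y‖ₑ
      ≤ ‖(2:ℂ) ^ j‖ₑ * ∫⁻ y, (haarIco j μ).indicator (fun _ => B) y := by
        gcongr
        refine (enorm_integral_le_lintegral_enorm _).trans (lintegral_mono fun y => ?_)
        rw [enorm_mul]
        refine (mul_le_mul' (hg y) (enorm_haarFn_le j μ y)).trans ?_
        by_cases hy : y ∈ haarIco j μ <;> simp [hy]
    _ = (‖(2:ℂ) ^ j‖ₑ * ENNReal.ofReal (2 ^ (-(j:ℤ)))) * B := by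
        rw [lintegral_indicator (measurableSet_haarIco j μ), setLIntegral_const, volume_haarIco]
        ring
    _ = B := by
        rw [← ofReal_norm, ← ENNReal.ofReal_mul (by positivity), norm_pow, Complex.norm_ofNat,
          two_zpow_neg_mul]
        simp

theorem integrable_schwartz_mul_haarFn (g : 𝓢(ℝ, ℂ)) (j : ℕ) (μ : ℤ) :
    Integrable (fun y => g y * haarFn j μ y) := by
  refine g.integrable.mul_bdd (c := 1) (measurable_haarFn j μ).aestronglyMeasurable
    (ae_of_all _ fun y => ?_)
  have h := enorm_haarFn_le j μ y
  have : ‖haarFn j μ y‖ₑ ≤ 1 := h.trans (Set.indicator_le_self' (by simp) y)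
  rw [← ofReal_norm, ← ENNReal.ofReal_one] at this
  exact (ENNReal.ofReal_le_ofReal_iff zero_le_one).1 this

theorem hcoef_add (f g : 𝓢(ℝ, ℂ)) (j : ℕ) (μ : ℤ) :
    hcoef j μ (f + g : 𝓢(ℝ, ℂ)) = hcoef j μ f + hcoef j μ g := by
  simp only [hcoef, ← mul_add]
  rw [← integral_add (integrable_schwartz_mul_haarFn f j μ) (integrable_schwartz_mul_haarFn g j μ)]
  simp [add_mul]

theorem enorm_hcoef_sum_le (F : ℕ → 𝓢(ℝ, ℂ)) (j : ℕ) (μ : ℤ) (n : ℕ) :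
    ‖hcoef j μ (∑ k ∈ Finset.range n, F k : 𝓢(ℝ, ℂ))‖ₑ ≤
      ∑ k ∈ Finset.range n, ‖hcoef j μ (F k)‖ₑ := by
  induction n with
  | zero => simp [hcoef]
  | succ n ih =>
    rw [Finset.sum_range_succ, Finset.sum_range_succ, hcoef_add]
    exact (enorm_add_le _ _).trans (add_le_add_left ih _)

theorem enorm_schwartz_le (g : 𝓢(ℝ, ℂ)) (y : ℝ) : ‖g y‖ₑ ≤ ∫⁻ ξ, ‖𝓕 g ξ‖ₑ := by
  have h : g y = 𝓕⁻ (𝓕 g) y := by rw [FourierTransform.fourierInv_fourier_eq]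
  rw [h, SchwartzMap.fourierInv_coe, Real.fourierInv_eq']
  refine (enorm_integral_le_lintegral_enorm _).trans (lintegral_mono fun v => ?_)
  rw [enorm_smul]
  simp only [← ofReal_norm]
  rw [Complex.norm_exp_ofReal_mul_I]
  simp

/-- If the partial sums of `F` have Fourier transforms approximating that of `f` through dilations
of a bump function, then the Haar coefficients of `f` are dominated by those of the pieces. -/
theorem enorm_hcoef_le_tsum {φ₀ : ℝ → ℂ} (hcont : Continuous φ₀) (hcpt : HasCompactSupport φ₀)
    (h0 : φ₀ 0 = 1) {f : 𝓢(ℝ, ℂ)} {F : ℕ → 𝓢(ℝ, ℂ)}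
    (hF : ∀ n ξ, 𝓕 (∑ k ∈ Finset.range (n + 1), F k) ξ = 𝓕 f ξ * φ₀ (((2:ℝ) ^ n)⁻¹ * ξ))
    (j : ℕ) (μ : ℤ) : ‖hcoef j μ f‖ₑ ≤ ∑' k, ‖hcoef j μ (F k)‖ₑ := by
  have hlim : Filter.Tendsto (fun n : ℕ => ∫⁻ ξ, ‖𝓕 f ξ * (1 - φ₀ (((2:ℝ) ^ n)⁻¹ * ξ))‖ₑ)
      Filter.atTop (nhds (∫⁻ _ : ℝ, 0)) := by
    obtain ⟨M, hM⟩ := hcpt.exists_bound_of_continuous hcont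
    refine tendsto_lintegral_of_dominated_convergence
      (fun ξ => ‖𝓕 f ξ‖ₑ * ENNReal.ofReal (1 + M)) (fun n => ?_) (fun n => ae_of_all _ fun ξ => ?_)
      ?_ (ae_of_all _ fun ξ => ?_)
    · have := (𝓕 f).continuous
      exact (Continuous.enorm (by fun_prop)).measurable
    · beta_reduce
      rw [enorm_mul]
      gcongr
      rw [← ofReal_norm]
      refine ENNReal.ofReal_le_ofReal ((norm_sub_le _ _).trans ?_)
      rw [norm_one]
      exact add_le_add_right (hM _) _
    · rw [lintegral_mul_const' _ _ (by simp)]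
      exact ENNReal.mul_ne_top (𝓕 f).integrable.2.ne (by simp)
    · have hpow : Filter.Tendsto (fun n : ℕ => ((2:ℝ) ^ n)⁻¹ * ξ) Filter.atTop (nhds (0 * ξ)) := by
        refine Filter.Tendsto.mul_const _ ?_
        simp only [← inv_pow]
        exact tendsto_pow_atTop_nhds_zero_of_lt_one (by norm_num) (by norm_num)
      rw [zero_mul] at hpow
      have h1 := (hcont.tendsto 0).comp hpow
      have h2 : Filter.Tendsto (fun n : ℕ => ‖𝓕 f ξ * (1 - φ₀ (((2:ℝ) ^ n)⁻¹ * ξ))‖ₑ)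
          Filter.atTop (nhds ‖𝓕 f ξ * (1 - φ₀ 0)‖ₑ) :=
        ((tendsto_const_nhds.sub h1).const_mul _).enorm
      simpa [h0] using h2
  rw [lintegral_zero] at hlim
  have hlim2 := hlim.const_add (∑' k, ‖hcoef j μ (F k)‖ₑ)
  rw [add_zero] at hlim2
  refine ge_of_tendsto' hlim2 fun n => ?_
  set S := ∑ k ∈ Finset.range (n + 1), F k with hS
  have e1 : f = S + (f - S) := by abel
  rw [show hcoef j μ f = hcoef j μ (S + (f - S) : 𝓢(ℝ, ℂ)) by rw [← e1], hcoef_add]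
  refine (enorm_add_le _ _).trans (add_le_add ?_ ?_)
  · exact (enorm_hcoef_sum_le F j μ (n + 1)).trans (ENNReal.sum_le_tsum _)
  · refine enorm_hcoef_le (fun y => (enorm_schwartz_le _ y).trans_eq ?_) j μ
    congr 1; ext ξ
    have : 𝓕 (f - S) = 𝓕 f - 𝓕 S := map_sub (fourierCLM ℂ 𝓢(ℝ, ℂ)) f S
    rw [this, sub_apply, hF n ξ]
    ring_nf

theorem contDiff_div_of_eq_zero {χ : ℝ → ℂ} (hχ : ContDiff ℝ (⊤ : ℕ∞) χ) {r : ℝ} (hr : 0 < r)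
    (h0 : ∀ ξ, |ξ| ≤ r → χ ξ = 0) :
    ContDiff ℝ (⊤ : ℕ∞) (fun ξ : ℝ => χ ξ / (2 * π * Complex.I * ξ)) := by
  rw [contDiff_iff_contDiffAt]
  intro ξ
  by_cases hξ : ξ = 0
  · subst hξ
    have : (fun ξ : ℝ => χ ξ / (2 * π * Complex.I * ξ)) =ᶠ[nhds 0] fun _ => 0 := by
      filter_upwards [Metric.ball_mem_nhds (0:ℝ) hr] with y hy
      rw [h0 y (by simpa using (Metric.mem_ball.1 hy).le), zero_div]
    exact contDiffAt_const.congr_of_eventuallyEq this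
  · simp only [div_eq_mul_inv]
    refine hχ.contDiffAt.mul (ContDiffAt.inv ?_ ?_)
    · exact contDiffAt_const.mul (Complex.ofRealCLM.contDiff.contDiffAt)
    · simp [hξ, Real.pi_ne_zero]

theorem exists_schwartz_fourier_eq {χ : ℝ → ℂ} (hχ : ContDiff ℝ (⊤ : ℕ∞) χ)
    (hc : HasCompactSupport χ) :
    ∃ Φ : 𝓢(ℝ, ℂ), (∀ ξ, 𝓕 Φ ξ = χ ξ) ∧ ⇑Φ = 𝓕⁻ χ := by
  refine ⟨𝓕⁻ (hc.toSchwartzMap hχ), fun ξ => ?_, ?_⟩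
  · rw [FourierTransform.fourier_fourierInv_eq]; rfl
  · rw [SchwartzMap.fourierInv_coe]; rfl

/-- The smoothing kernels behind `LPop`, with reproducing kernels. -/
theorem exists_kernels {φ₀ : ℝ → ℂ} (hφsmooth : ContDiff ℝ (⊤ : ℕ∞) φ₀)
    (hφcpt : HasCompactSupport φ₀) (hφone : ∀ ξ : ℝ, |ξ| ≤ 4/3 → φ₀ ξ = 1)
    (hφzero : ∀ ξ : ℝ, 3/2 ≤ |ξ| → φ₀ ξ = 0) :
    ∃ Φ₀ Φ Ψ₀ Θ : 𝓢(ℝ, ℂ), (∀ ξ, 𝓕 Φ₀ ξ = φ₀ ξ) ∧ (∀ ξ, 𝓕 Φ ξ = φ₀ ξ - φ₀ (2 * ξ)) ∧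
      (∀ ξ, 𝓕 Φ₀ ξ * 𝓕 Ψ₀ ξ = 𝓕 Φ₀ ξ) ∧
      (∀ ξ, 𝓕 Φ ξ * 𝓕 (SchwartzMap.derivCLM ℂ ℂ Θ) ξ = 𝓕 Φ ξ) ∧
      (∀ g, LPop φ₀ 0 g = conv g (dil 0 Φ₀)) ∧
      (∀ k g, LPop φ₀ (k + 1) g = conv g (dil (k + 1) Φ)) := by
  have hsc (c : ℝ) (hc : c ≠ 0) : ContDiff ℝ (⊤ : ℕ∞) (fun ξ => φ₀ (c * ξ)) ∧
      HasCompactSupport (fun ξ => φ₀ (c * ξ)) :=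
    ⟨hφsmooth.comp (contDiff_const.mul contDiff_id),
      hφcpt.comp_homeomorph (Homeomorph.mulLeft₀ c hc)⟩
  obtain ⟨s2, c2⟩ := hsc 2 (by norm_num)
  obtain ⟨s4, c4⟩ := hsc 4 (by norm_num)
  obtain ⟨sh, ch⟩ := hsc (1 / 2) (by norm_num)
  obtain ⟨Φ₀, hΦ₀, eΦ₀⟩ := exists_schwartz_fourier_eq hφsmooth hφcpt
  obtain ⟨Φ, hΦ, eΦ⟩ := exists_schwartz_fourier_eq (hφsmooth.sub s2) (hφcpt.sub c2)
  obtain ⟨Ψ₀, hΨ₀, -⟩ := exists_schwartz_fourier_eq sh ch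
  have hz : ∀ ξ : ℝ, |ξ| ≤ 1 / 3 → φ₀ (1 / 2 * ξ) - φ₀ (4 * ξ) = 0 := fun ξ hξ => by
    rw [hφone, hφone, sub_self]
    · rw [abs_mul, abs_of_pos (by norm_num : (0:ℝ) < 4)]; linarith
    · rw [abs_mul, abs_of_pos (by norm_num : (0:ℝ) < 1 / 2)]; linarith
  obtain ⟨Θ, hΘ, -⟩ := exists_schwartz_fourier_eq
    (contDiff_div_of_eq_zero (sh.sub s4) (by norm_num : (0:ℝ) < 1 / 3) hz)
    (by
      simp only [div_eq_mul_inv]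
      exact (ch.sub c4).mul_right)
  refine ⟨Φ₀, Φ, Ψ₀, Θ, hΦ₀, hΦ, fun ξ => ?_, fun ξ => ?_, fun g => ?_, fun k g => ?_⟩
  · rw [hΦ₀, hΨ₀]
    by_cases h : 3 / 2 ≤ |ξ|
    · simp [hφzero ξ h]
    · rw [hφone (1 / 2 * ξ), mul_one]
      rw [abs_mul, abs_of_pos (by norm_num : (0:ℝ) < 1 / 2)]; linarith
  · rw [hΦ, fourier_derivCLM, hΘ]
    by_cases h : |ξ| ≤ 2 / 3
    · rw [hφone ξ (by linarith), hφone (2 * ξ)]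
      · simp
      · rw [abs_mul, abs_of_pos (by norm_num : (0:ℝ) < 2)]; linarith
    · push Not at h
      have hξ : (ξ:ℂ) ≠ 0 := by
        intro h'
        rw [Complex.ofReal_eq_zero] at h'
        rw [h', abs_zero] at h; norm_num at h
      have hne : 2 * (π:ℂ) * Complex.I * ξ ≠ 0 := by simp [hξ, Real.pi_ne_zero]
      rw [mul_div_cancel₀ _ hne]
      by_cases h' : 3 / 2 ≤ |ξ|
      · rw [hφzero ξ h', hφzero (2 * ξ)]
        · simp
        · rw [abs_mul, abs_of_pos (by norm_num : (0:ℝ) < 2)]; linarith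
      · rw [hφone (1 / 2 * ξ), hφzero (4 * ξ)]
        · simp
        · rw [abs_mul, abs_of_pos (by norm_num : (0:ℝ) < 4)]; linarith
        · rw [abs_mul, abs_of_pos (by norm_num : (0:ℝ) < 1 / 2)]; linarith
  · have : ⇑(dil 0 Φ₀) = 𝓕⁻ φ₀ := by ext x; simp [dil_apply, eΦ₀]
    rw [this]; simp [LPop]
  · have : ⇑(dil (k + 1) Φ) = fun x => (2:ℂ) ^ (k + 1) *
        (𝓕⁻ (fun ξ => φ₀ ξ - φ₀ (2 * ξ))) ((2:ℝ) ^ (k + 1) * x) := by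
      ext x; rw [dil_apply, eΦ]
    rw [this]; simp [LPop]

/-- The Littlewood–Paley pieces of a Haar function. -/
theorem exists_enorm_LPop_haarFn_le {φ₀ : ℝ → ℂ} (hφsmooth : ContDiff ℝ (⊤ : ℕ∞) φ₀)
    (hφcpt : HasCompactSupport φ₀) (hφone : ∀ ξ : ℝ, |ξ| ≤ 4/3 → φ₀ ξ = 1)
    (hφzero : ∀ ξ : ℝ, 3/2 ≤ |ξ| → φ₀ ξ = 0) :
    ∃ C : NNReal, ∀ (k j : ℕ) (μ : ℤ) (x : ℝ), ‖LPop φ₀ k (haarFn j μ) x‖ₑ ≤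
      C * (2:ℝ≥0∞)⁻¹ ^ (j - k) * avg k ((haarIco j μ).indicator 1) x := by
  obtain ⟨Φ₀, Φ, Ψ₀, Θ, -, -, -, -, e0, e1⟩ := exists_kernels hφsmooth hφcpt hφone hφzero
  have key (Φ : 𝓢(ℝ, ℂ)) : ∃ C : NNReal, ∀ (k j : ℕ) (μ : ℤ) (x : ℝ),
      ‖conv (haarFn j μ) (dil k Φ) x‖ₑ ≤
        C * (2:ℝ≥0∞)⁻¹ ^ (j - k) * avg k ((haarIco j μ).indicator 1) x := by
    obtain ⟨A, hA⟩ := exists_enorm_conv_haarFn_le Φ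
    obtain ⟨B, hB⟩ := exists_enorm_conv_haarFn_le_of_le Φ
    refine ⟨A + B, fun k j μ x => ?_⟩
    rcases le_total k j with h | h
    · refine (hB k j μ x h).trans ?_
      gcongr
      simp
    · rw [Nat.sub_eq_zero_of_le h, pow_zero, mul_one]
      refine (hA k j μ x).trans ?_
      gcongr
      simp
  obtain ⟨A, hA⟩ := key Φ₀
  obtain ⟨B, hB⟩ := key Φ
  refine ⟨A + B, fun k j μ x => ?_⟩
  cases k with
  | zero =>
    rw [e0]
    refine (hA 0 j μ x).trans ?_
    gcongr
    simp
  | succ k =>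
    rw [e1]
    refine (hB (k + 1) j μ x).trans ?_
    gcongr
    simp

/-- The Haar coefficients of the Littlewood–Paley pieces of a Schwartz function. -/
theorem exists_enorm_hcoef_LPop_le {φ₀ : ℝ → ℂ} (hφsmooth : ContDiff ℝ (⊤ : ℕ∞) φ₀)
    (hφcpt : HasCompactSupport φ₀) (hφone : ∀ ξ : ℝ, |ξ| ≤ 4/3 → φ₀ ξ = 1)
    (hφzero : ∀ ξ : ℝ, 3/2 ≤ |ξ| → φ₀ ξ = 0) :
    ∃ C : NNReal, ∀ f : 𝓢(ℝ, ℂ), (∀ k, Measurable (LPop φ₀ k f)) ∧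
      (∀ j μ, ‖hcoef j μ f‖ₑ ≤ ∑' k, ‖hcoef j μ (LPop φ₀ k f)‖ₑ) ∧
      (∀ k j μ, k ≤ j → ∀ x ∈ haarIco j μ,
        ‖hcoef j μ (LPop φ₀ k f)‖ₑ ≤ C * avg k (fun t => ‖LPop φ₀ k f t‖ₑ) x) ∧
      (∀ k j μ, j < k → ‖hcoef j μ (LPop φ₀ k f)‖ₑ ≤ C * (2:ℝ≥0∞)⁻¹ ^ (k - j) *
        (avg k (fun t => ‖LPop φ₀ k f t‖ₑ) (dyadicPt j μ) +
        avg k (fun t => ‖LPop φ₀ k f t‖ₑ) (dyadicPt j (μ + 1 / 2)) +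
        avg k (fun t => ‖LPop φ₀ k f t‖ₑ) (dyadicPt j (μ + 1)))) := by
  obtain ⟨Φ₀, Φ, Ψ₀, Θ, h0, h1, r0, r1, e0, e1⟩ := exists_kernels hφsmooth hφcpt hφone hφzero
  obtain ⟨A, hA⟩ := exists_enorm_hcoef_le_avg Ψ₀
  obtain ⟨B, hB⟩ := exists_enorm_hcoef_le_avg (SchwartzMap.derivCLM ℂ ℂ Θ)
  obtain ⟨D, hD⟩ := exists_enorm_hcoef_le_avg_endpoints Θ
  refine ⟨A + B + D, fun f => ?_⟩
  set F : ℕ → 𝓢(ℝ, ℂ) := fun k => sconv f (dil k (if k = 0 then Φ₀ else Φ)) with hF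
  have hLF (k : ℕ) : LPop φ₀ k f = F k := by
    cases k with
    | zero => rw [e0]; ext x; simp [hF, sconv_apply]
    | succ k => rw [e1]; ext x; simp [hF, sconv_apply]
  have hR0 : sconv (F 0) (dil 0 Ψ₀) = F 0 := by
    simpa [hF] using sconv_sconv_dil r0 0 f
  have hR1 (k : ℕ) : sconv (F (k + 1)) (dil (k + 1) (SchwartzMap.derivCLM ℂ ℂ Θ)) = F (k + 1) := by
    simpa [hF] using sconv_sconv_dil r1 (k + 1) f
  simp only [hLF]
  refine ⟨fun k => (F k).continuous.measurable, ?_, ?_, ?_⟩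
  · refine enorm_hcoef_le_tsum hφsmooth.continuous hφcpt (hφone 0 (by norm_num)) fun n ξ => ?_
    induction n with
    | zero => simp [hF, fourier_sconv, fourier_dil, h0]
    | succ n ih =>
      have hadd (a b : 𝓢(ℝ, ℂ)) : 𝓕 (a + b) = 𝓕 a + 𝓕 b := map_add (fourierCLM ℂ 𝓢(ℝ, ℂ)) a b
      rw [Finset.sum_range_succ, hadd, add_apply, ih]
      simp only [hF, fourier_sconv, fourier_dil, if_neg (Nat.succ_ne_zero n), h1]
      rw [show 2 * (((2:ℝ) ^ (n + 1))⁻¹ * ξ) = ((2:ℝ) ^ n)⁻¹ * ξ by rw [pow_succ]; field_simp]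
      ring
  · intro k j μ hkj x hx
    cases k with
    | zero =>
      refine (hA 0 j μ (F 0) hkj hR0 x hx).trans ?_
      gcongr
      rw [add_assoc]; exact_mod_cast le_self_add
    | succ k =>
      refine (hB (k + 1) j μ (F (k + 1)) hkj (hR1 k) x hx).trans ?_
      gcongr
      rw [add_comm A, add_assoc]; exact_mod_cast le_self_add
  · intro k j μ hjk
    cases k with
    | zero => omega
    | succ k =>
      refine (hD (k + 1) j μ (F (k + 1)) hjk.le (hR1 k)).trans ?_
      gcongr
      exact_mod_cast le_add_self

theorem integrable_haarFn_mul (j : ℕ) (μ : ℤ) (K : 𝓢(ℝ, ℂ)) (x : ℝ) :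
    Integrable (fun t => haarFn j μ t * K (x - t)) := by
  refine (K.integrable.comp_sub_left x).bdd_mul (c := 1)
    (measurable_haarFn j μ).aestronglyMeasurable (ae_of_all _ fun y => ?_)
  have h := enorm_haarFn_le j μ y
  have : ‖haarFn j μ y‖ₑ ≤ 1 := h.trans (Set.indicator_le_self' (by simp) y)
  rw [← ofReal_norm, ← ENNReal.ofReal_one] at this
  exact (ENNReal.ofReal_le_ofReal_iff zero_le_one).1 this

theorem enorm_LPop_haarProj_le {φ₀ : ℝ → ℂ} (hφsmooth : ContDiff ℝ (⊤ : ℕ∞) φ₀)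
    (hφcpt : HasCompactSupport φ₀) (hφone : ∀ ξ : ℝ, |ξ| ≤ 4/3 → φ₀ ξ = 1)
    (hφzero : ∀ ξ : ℝ, 3/2 ≤ |ξ| → φ₀ ξ = 0) (E : Finset (ℕ × ℤ)) (f : ℝ → ℂ) (k : ℕ) (x : ℝ) :
    ‖LPop φ₀ k (haarProj E f) x‖ₑ ≤
      ∑ e ∈ E, ‖hcoef e.1 e.2 f‖ₑ * ‖LPop φ₀ k (haarFn e.1 e.2) x‖ₑ := by
  obtain ⟨Φ₀, Φ, Ψ₀, Θ, -, -, -, -, e0, e1⟩ := exists_kernels hφsmooth hφcpt hφone hφzero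
  have key (K : 𝓢(ℝ, ℂ)) : ‖conv (haarProj E f) K x‖ₑ ≤
      ∑ e ∈ E, ‖hcoef e.1 e.2 f‖ₑ * ‖conv (haarFn e.1 e.2) K x‖ₑ := by
    have : conv (haarProj E f) K x = ∑ e ∈ E, hcoef e.1 e.2 f * conv (haarFn e.1 e.2) K x := by
      have h1 (t : ℝ) : haarProj E f t * K (x - t) =
          ∑ e ∈ E, hcoef e.1 e.2 f * (haarFn e.1 e.2 t * K (x - t)) := by
        simp only [haarProj, Finset.sum_mul, ← mul_assoc, hcoef]
      simp only [conv, h1]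
      rw [integral_finsetSum _ fun e _ => (integrable_haarFn_mul e.1 e.2 K x).const_mul _]
      simp only [integral_const_mul]
    rw [this]
    refine (enorm_sum_le _ _).trans_eq ?_
    simp only [enorm_mul]
  cases k with
  | zero => simp only [e0]; exact key _
  | succ k => simp only [e1]; exact key _

/-- A two-sided geometric weight. -/
def geom (θ : ℝ≥0∞) (k j : ℕ) : ℝ≥0∞ := θ ^ ((k - j) + (j - k))

theorem geom_comm (θ : ℝ≥0∞) (k j : ℕ) : geom θ k j = geom θ j k := by
  unfold geom; rw [add_comm]

theorem tsum_geom_le {θ : ℝ≥0∞} (hθ : θ < 1) (k : ℕ) :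
    ∑' j, geom θ k j ≤ 2 * (1 - θ)⁻¹ := by
  have h1 : ∑ j ∈ Finset.range k, geom θ k j ≤ (1 - θ)⁻¹ := by
    rw [← ENNReal.tsum_geometric]
    refine le_trans ?_ (ENNReal.sum_le_tsum (Finset.range k))
    rw [← Finset.sum_range_reflect (fun i => θ ^ i)]
    refine Finset.sum_le_sum fun j hj => ?_
    rw [Finset.mem_range] at hj
    unfold geom
    exact pow_le_pow_right_of_le_one' hθ.le (by omega)
  have h2 : ∑' j, geom θ k (j + k) ≤ (1 - θ)⁻¹ := by
    rw [← ENNReal.tsum_geometric]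
    refine ENNReal.tsum_le_tsum fun j => ?_
    unfold geom
    exact pow_le_pow_right_of_le_one' hθ.le (by omega)
  have h3 := Summable.sum_add_tsum_nat_add' (k := k) (f := geom θ k) ENNReal.summable
  rw [← h3, two_mul]
  exact add_le_add h1 h2

theorem tsum_geom_mul_rpow_le {q : ℝ} (hq : 1 < q) {θ : ℝ≥0∞} (hθ : θ < 1) (u : ℕ → ℝ≥0∞) (k : ℕ) :
    (∑' j, geom θ k j * u j) ^ q ≤ (2 * (1 - θ)⁻¹) ^ (q - 1) * ∑' j, geom θ k j * u j ^ q := by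
  refine (rpow_tsum_mul_le _ _ hq).trans ?_
  exact mul_le_mul_left (ENNReal.rpow_le_rpow (tsum_geom_le hθ k) (by linarith)) _

theorem exists_lintegral_tsum_geom_avg_le {q r : ℝ} (hq : 1 < q) (hr : 1 < r) {θ : ℝ≥0∞}
    (hθ : θ < 1) : ∃ C : ℝ≥0∞, C ≠ ∞ ∧ ∀ G : ℕ → ℝ → ℝ≥0∞, (∀ j, Measurable (G j)) →
      ∫⁻ x, (∑' k, (∑' j, geom θ k j * avg k (G j) x) ^ q) ^ r ≤
        C * ∫⁻ x, (∑' j, G j x ^ q) ^ r := by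
  obtain ⟨D, hD⟩ := lintegral_tsum_avg_rpow_le hr
  set R : ℝ≥0∞ := 2 * (1 - θ)⁻¹ with hR
  have hRt : R ≠ ∞ := ENNReal.mul_ne_top (by simp) (ENNReal.inv_ne_top.2 (tsub_pos_of_lt hθ).ne')
  have h1 : (0:ℝ) ≤ q - 1 := by linarith
  have h2 : (0:ℝ) ≤ r := by linarith
  set B : ℝ≥0∞ := R ^ (q - 1) * 16 ^ (q - 1) with hB
  have hBt : B ≠ ∞ := ENNReal.mul_ne_top (ENNReal.rpow_ne_top_of_nonneg h1 hRt)
    (ENNReal.rpow_ne_top_of_nonneg h1 (by simp))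
  refine ⟨B ^ r * (D * R ^ r), ENNReal.mul_ne_top (ENNReal.rpow_ne_top_of_nonneg h2 hBt)
    (ENNReal.mul_ne_top (by simp) (ENNReal.rpow_ne_top_of_nonneg h2 hRt)), fun G hG => ?_⟩
  set F : ℕ → ℝ → ℝ≥0∞ := fun k x => ∑' j, geom θ k j * G j x ^ q with hF
  have hFm (k : ℕ) : Measurable (F k) := Measurable.tsum fun j => by fun_prop
  have hpt (k : ℕ) (x : ℝ) : (∑' j, geom θ k j * avg k (G j) x) ^ q ≤ B * avg k (F k) x := by
    refine (tsum_geom_mul_rpow_le hq hθ _ k).trans ?_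
    rw [hB, mul_assoc]
    gcongr
    rw [hF, avg_tsum k (fun j => by fun_prop), ← ENNReal.tsum_mul_left]
    refine ENNReal.tsum_le_tsum fun j => ?_
    rw [avg_const_mul k _ (by fun_prop), mul_left_comm]
    gcongr
    exact avg_rpow_le k (hG j) hq x
  calc ∫⁻ x, (∑' k, (∑' j, geom θ k j * avg k (G j) x) ^ q) ^ r
      ≤ ∫⁻ x, B ^ r * (∑' k, avg k (F k) x) ^ r := by
        refine lintegral_mono fun x => ?_
        rw [← ENNReal.mul_rpow_of_nonneg _ _ h2, ← ENNReal.tsum_mul_left]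
        gcongr with k
        exact hpt k x
    _ = B ^ r * ∫⁻ x, (∑' k, avg k (F k) x) ^ r :=
        lintegral_const_mul' _ _ (ENNReal.rpow_ne_top_of_nonneg h2 hBt)
    _ ≤ B ^ r * (D * ∫⁻ x, (∑' k, F k x) ^ r) := by gcongr; exact hD F hFm
    _ ≤ B ^ r * (D * ∫⁻ x, R ^ r * (∑' j, G j x ^ q) ^ r) := by
        gcongr with x
        rw [← ENNReal.mul_rpow_of_nonneg _ _ h2, hF, ENNReal.tsum_comm, ← ENNReal.tsum_mul_left]
        gcongr with j
        rw [ENNReal.tsum_mul_right]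
        gcongr
        simp only [geom_comm θ _ j]
        exact tsum_geom_le hθ j
    _ = _ := by
        rw [lintegral_const_mul' _ _ (ENNReal.rpow_ne_top_of_nonneg h2 hRt)]; ring

theorem exists_lintegral_tsum_geom_avg_le' {q r : ℝ} (hq : 1 < q) (hr : 1 < r) {θ : ℝ≥0∞}
    (hθ : θ < 1) : ∃ C : ℝ≥0∞, C ≠ ∞ ∧ ∀ H : ℕ → ℝ → ℝ≥0∞, (∀ j, Measurable (H j)) →
      ∫⁻ x, (∑' j, (∑' k, geom θ j k * avg k (H k) x) ^ q) ^ r ≤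
        C * ∫⁻ x, (∑' k, H k x ^ q) ^ r := by
  obtain ⟨D, hD⟩ := lintegral_tsum_avg_rpow_le hr
  set R : ℝ≥0∞ := 2 * (1 - θ)⁻¹ with hR
  have hRt : R ≠ ∞ := ENNReal.mul_ne_top (by simp) (ENNReal.inv_ne_top.2 (tsub_pos_of_lt hθ).ne')
  have h1 : (0:ℝ) ≤ q - 1 := by linarith
  have h2 : (0:ℝ) ≤ r := by linarith
  set B : ℝ≥0∞ := R ^ (q - 1) * R * 16 ^ (q - 1) with hB
  have hBt : B ≠ ∞ := ENNReal.mul_ne_top (ENNReal.mul_ne_top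
    (ENNReal.rpow_ne_top_of_nonneg h1 hRt) hRt) (ENNReal.rpow_ne_top_of_nonneg h1 (by simp))
  refine ⟨B ^ r * D, ENNReal.mul_ne_top (ENNReal.rpow_ne_top_of_nonneg h2 hBt) (by simp),
    fun H hH => ?_⟩
  have hpt (x : ℝ) : ∑' j, (∑' k, geom θ j k * avg k (H k) x) ^ q ≤
      B * ∑' k, avg k (fun t => H k t ^ q) x := by
    calc ∑' j, (∑' k, geom θ j k * avg k (H k) x) ^ q
        ≤ ∑' j, R ^ (q - 1) * ∑' k, geom θ j k * avg k (H k) x ^ q :=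
          ENNReal.tsum_le_tsum fun j => tsum_geom_mul_rpow_le hq hθ _ j
      _ = R ^ (q - 1) * ∑' k, (∑' j, geom θ j k) * avg k (H k) x ^ q := by
          rw [ENNReal.tsum_mul_left, ENNReal.tsum_comm]
          simp only [ENNReal.tsum_mul_right]
      _ ≤ R ^ (q - 1) * ∑' k, R * (16 ^ (q - 1) * avg k (fun t => H k t ^ q) x) := by
          gcongr with k
          · simp only [geom_comm θ _ k]
            exact tsum_geom_le hθ k
          · exact avg_rpow_le k (hH k) hq x
      _ = _ := by
          simp only [ENNReal.tsum_mul_left]; rw [hB]; ring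
  calc ∫⁻ x, (∑' j, (∑' k, geom θ j k * avg k (H k) x) ^ q) ^ r
      ≤ ∫⁻ x, B ^ r * (∑' k, avg k (fun t => H k t ^ q) x) ^ r := by
        refine lintegral_mono fun x => ?_
        rw [← ENNReal.mul_rpow_of_nonneg _ _ h2]
        gcongr
        exact hpt x
    _ = B ^ r * ∫⁻ x, (∑' k, avg k (fun t => H k t ^ q) x) ^ r :=
        lintegral_const_mul' _ _ (ENNReal.rpow_ne_top_of_nonneg h2 hBt)
    _ ≤ B ^ r * (D * ∫⁻ x, (∑' k, H k x ^ q) ^ r) := by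
        gcongr; exact hD _ fun k => by fun_prop
    _ = _ := by ring

theorem sum_sum_shift_le (A : Finset ℕ) (N : ℕ) (c : ℕ)
    (hc : ∀ k, (A.filter (fun j => j < k ∧ k ≤ j + N)).card ≤ c) (y : ℕ → ℝ≥0∞) :
    ∑ j ∈ A, ∑ n ∈ Finset.range N, y (j + 1 + n) ≤ c * ∑' k, y k := by
  calc ∑ j ∈ A, ∑ n ∈ Finset.range N, y (j + 1 + n)
      ≤ ∑ j ∈ A, ∑' k, if j < k ∧ k ≤ j + N then y k else 0 := by
        refine Finset.sum_le_sum fun j _ => ?_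
        set f : ℕ → ℝ≥0∞ := fun k => if j < k ∧ k ≤ j + N then y k else 0 with hf
        have h1 : ∑ n ∈ Finset.range N, y (j + 1 + n) = ∑ n ∈ Finset.range N, f (j + 1 + n) := by
          refine Finset.sum_congr rfl fun n hn => ?_
          rw [Finset.mem_range] at hn
          rw [hf]; exact (if_pos ⟨by omega, by omega⟩).symm
        rw [h1]
        exact (ENNReal.sum_le_tsum _).trans
          (ENNReal.tsum_comp_le_tsum_of_injective (add_right_injective (j + 1)) f)
    _ = ∑' k, ∑ j ∈ A, if j < k ∧ k ≤ j + N then y k else 0 :=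
        (Summable.tsum_finsetSum fun _ _ => ENNReal.summable).symm
    _ ≤ ∑' k, c * y k := by
        refine ENNReal.tsum_le_tsum fun k => ?_
        rw [← Finset.sum_filter, Finset.sum_const, nsmul_eq_mul]
        gcongr
        exact_mod_cast hc k
    _ = _ := ENNReal.tsum_mul_left

theorem exists_lintegral_middle_le {q r : ℝ} (hq : 1 < q) (hr : 1 < r) :
    ∃ C : ℝ≥0∞, C ≠ ∞ ∧ ∀ (A : Finset ℕ) (N c : ℕ),
      (∀ k, (A.filter (fun j => j < k ∧ k ≤ j + N)).card ≤ c) →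
      ∀ H : ℕ → ℝ → ℝ≥0∞, (∀ j, Measurable (H j)) →
      ∫⁻ x, (∑ j ∈ A, (∑ n ∈ Finset.range N,
        (avg j (fun t => H (j + 1 + n) t ^ q) x) ^ (1 / q)) ^ q) ^ r ≤
        C * ((N:ℝ≥0∞) ^ (q - 1) * c) ^ r * ∫⁻ x, (∑' k, H k x ^ q) ^ r := by
  obtain ⟨D, hD⟩ := lintegral_tsum_avg_rpow_le hr
  have h1 : (0:ℝ) ≤ q - 1 := by linarith
  have h2 : (0:ℝ) ≤ r := by linarith
  refine ⟨D, by simp, fun A N c hc H hH => ?_⟩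
  set F : ℕ → ℝ → ℝ≥0∞ := fun j x =>
    if j ∈ A then ∑ n ∈ Finset.range N, H (j + 1 + n) x ^ q else 0 with hF
  have hFm (j : ℕ) : Measurable (F j) := by
    by_cases hj : j ∈ A
    · simp only [hF, if_pos hj]; fun_prop
    · simp only [hF, if_neg hj]; fun_prop
  have hBt : ((N:ℝ≥0∞) ^ (q - 1)) ^ r ≠ ∞ := ENNReal.rpow_ne_top_of_nonneg h2
    (ENNReal.rpow_ne_top_of_nonneg h1 (by simp))
  calc _ ≤ ∫⁻ x, ((N:ℝ≥0∞) ^ (q - 1)) ^ r * (∑' j, avg j (F j) x) ^ r := by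
        refine lintegral_mono fun x => ?_
        rw [← ENNReal.mul_rpow_of_nonneg _ _ h2]
        refine ENNReal.rpow_le_rpow ?_ h2
        refine le_trans ?_ (mul_le_mul_right (ENNReal.sum_le_tsum A) _)
        rw [Finset.mul_sum]
        refine Finset.sum_le_sum fun j hj => ?_
        refine (ENNReal.rpow_sum_le_const_mul_sum_rpow _ _ hq.le).trans ?_
        rw [Finset.card_range]
        refine mul_le_mul_right (le_of_eq ?_) _
        simp only [hF, if_pos hj, ← ENNReal.rpow_mul, one_div,
          inv_mul_cancel₀ (show q ≠ 0 by linarith), ENNReal.rpow_one]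
        unfold avg
        rw [← lintegral_finsetSum _ fun n _ => by fun_prop]
        simp only [Finset.mul_sum]
    _ = ((N:ℝ≥0∞) ^ (q - 1)) ^ r * ∫⁻ x, (∑' j, avg j (F j) x) ^ r :=
        lintegral_const_mul' _ _ hBt
    _ ≤ ((N:ℝ≥0∞) ^ (q - 1)) ^ r * (D * ∫⁻ x, (∑' j, F j x) ^ r) := by
        gcongr; exact hD F hFm
    _ ≤ ((N:ℝ≥0∞) ^ (q - 1)) ^ r * (D * ∫⁻ x, (c:ℝ≥0∞) ^ r * (∑' k, H k x ^ q) ^ r) := by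
        gcongr with x
        rw [← ENNReal.mul_rpow_of_nonneg _ _ h2]
        refine ENNReal.rpow_le_rpow ?_ h2
        refine le_trans (le_of_eq ?_) (sum_sum_shift_le A N c hc fun k => H k x ^ q)
        rw [tsum_eq_sum (s := A) fun j hj => by simp only [hF, if_neg hj]]
        exact Finset.sum_congr rfl fun j hj => by simp only [hF, if_pos hj]
    _ = _ := by
        rw [lintegral_const_mul' _ _ (ENNReal.rpow_ne_top_of_nonneg h2 (by simp)),
          ENNReal.mul_rpow_of_nonneg _ _ h2]
        ring

theorem sum_rpow_le_rpow_sum {ι : Type*} (s : Finset ι) (y : ι → ℝ≥0∞) {q : ℝ} (hq : 1 ≤ q) :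
    ∑ j ∈ s, y j ^ q ≤ (∑ j ∈ s, y j) ^ q := by
  classical
  induction s using Finset.induction_on with
  | empty => simp
  | insert a s ha ih =>
    rw [Finset.sum_insert ha, Finset.sum_insert ha]
    exact (add_le_add_right ih _).trans (ENNReal.add_rpow_le_rpow_add _ _ hq)

theorem exists_lintegral_high_le {p q : ℝ} (hq : 1 < q) (hqp : q < p) {θ : ℝ≥0∞} (hθ : θ < 1) :
    ∃ C : ℝ≥0∞, C ≠ ∞ ∧ ∀ (A : Finset ℕ) (N : ℕ), (A.card : ℝ≥0∞) * θ ^ N ≤ 1 →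
      ∀ H : ℕ → ℝ → ℝ≥0∞, (∀ j, Measurable (H j)) →
      ∫⁻ x, (∑ j ∈ A, (∑' m, θ ^ (N + m) *
        (avg j (fun t => H (j + 1 + N + m) t ^ p) x) ^ (1 / p)) ^ q) ^ (p / q) ≤
        C * ∫⁻ x, (∑' k, H k x ^ q) ^ (p / q) := by
  set R : ℝ≥0∞ := (1 - θ)⁻¹ with hR
  have hRt : R ≠ ∞ := ENNReal.inv_ne_top.2 (tsub_pos_of_lt hθ).ne'
  have hp : 1 < p := hq.trans hqp
  have hq0 : 0 < q := by linarith
  have hp1 : 0 ≤ p - 1 := by linarith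
  refine ⟨R ^ (p - 1) * R * 16, ENNReal.mul_ne_top (ENNReal.mul_ne_top
    (ENNReal.rpow_ne_top_of_nonneg hp1 hRt) hRt) (by simp), fun A N hA H hH => ?_⟩
  set X := ∫⁻ x, (∑' k, H k x ^ q) ^ (p / q) with hX
  have hHX (k : ℕ) : ∫⁻ x, H k x ^ p ≤ X := by
    refine lintegral_mono fun x => ?_
    rw [show H k x ^ p = (H k x ^ q) ^ (p / q) by
      rw [← ENNReal.rpow_mul, mul_div_cancel₀ _ hq0.ne']]
    exact ENNReal.rpow_le_rpow (ENNReal.le_tsum (f := fun k => H k x ^ q) k) (by positivity)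
  have hsum : ∑' m, θ ^ (N + m) = θ ^ N * R := by
    simp only [pow_add, ENNReal.tsum_mul_left, ENNReal.tsum_geometric, hR]
  set V : ℝ → ℝ≥0∞ := fun x => ∑ j ∈ A, ∑' m, θ ^ (N + m) *
    avg j (fun t => H (j + 1 + N + m) t ^ p) x with hV
  have hpt (x : ℝ) : (∑ j ∈ A, (∑' m, θ ^ (N + m) *
        (avg j (fun t => H (j + 1 + N + m) t ^ p) x) ^ (1 / p)) ^ q) ^ (p / q) ≤
      R ^ (p - 1) * V x := by
    calc _ ≤ ((∑ j ∈ A, ∑' m, θ ^ (N + m) *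
          (avg j (fun t => H (j + 1 + N + m) t ^ p) x) ^ (1 / p)) ^ q) ^ (p / q) :=
          ENNReal.rpow_le_rpow (sum_rpow_le_rpow_sum _ _ hq.le) (by positivity)
      _ = (∑ j ∈ A, ∑' m, θ ^ (N + m) *
          (avg j (fun t => H (j + 1 + N + m) t ^ p) x) ^ (1 / p)) ^ p := by
          rw [← ENNReal.rpow_mul, mul_div_cancel₀ _ hq0.ne']
      _ ≤ (A.card : ℝ≥0∞) ^ (p - 1) * ∑ j ∈ A, (∑' m, θ ^ (N + m) *
          (avg j (fun t => H (j + 1 + N + m) t ^ p) x) ^ (1 / p)) ^ p :=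
          ENNReal.rpow_sum_le_const_mul_sum_rpow _ _ hp.le
      _ ≤ (A.card : ℝ≥0∞) ^ (p - 1) * ∑ j ∈ A, (θ ^ N * R) ^ (p - 1) * ∑' m, θ ^ (N + m) *
          avg j (fun t => H (j + 1 + N + m) t ^ p) x := by
          refine mul_le_mul_right (Finset.sum_le_sum fun j _ => ?_) _
          refine (rpow_tsum_mul_le _ _ hp).trans ?_
          rw [hsum]
          simp only [← ENNReal.rpow_mul, one_div, inv_mul_cancel₀ (show p ≠ 0 by linarith),
            ENNReal.rpow_one, le_refl]
      _ = (A.card * θ ^ N) ^ (p - 1) * R ^ (p - 1) * V x := by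
          rw [← Finset.mul_sum, ← mul_assoc, ← ENNReal.mul_rpow_of_nonneg _ _ hp1,
            ← ENNReal.mul_rpow_of_nonneg _ _ hp1, mul_assoc]
      _ ≤ 1 * R ^ (p - 1) * V x := by
          gcongr
          exact ENNReal.rpow_le_one hA hp1
      _ = _ := by rw [one_mul]
  calc _ ≤ ∫⁻ x, R ^ (p - 1) * V x := lintegral_mono hpt
    _ = R ^ (p - 1) * ∫⁻ x, V x :=
        lintegral_const_mul' _ _ (ENNReal.rpow_ne_top_of_nonneg hp1 hRt)
    _ = R ^ (p - 1) * ∑ j ∈ A, ∑' m, θ ^ (N + m) *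
          ∫⁻ x, avg j (fun t => H (j + 1 + N + m) t ^ p) x := by
        rw [hV, lintegral_finsetSum _ fun j _ => Measurable.tsum fun m => by fun_prop]
        congr 1
        refine Finset.sum_congr rfl fun j _ => ?_
        rw [lintegral_tsum fun m => by fun_prop]
        refine tsum_congr fun m => lintegral_const_mul _ (by fun_prop)
    _ ≤ R ^ (p - 1) * ∑ j ∈ A, ∑' m, θ ^ (N + m) * (16 * X) := by
        gcongr with j _ m
        exact (lintegral_avg_le j (by fun_prop)).trans (mul_le_mul_right (hHX _) _)
    _ = R ^ (p - 1) * (A.card * θ ^ N * (R * (16 * X))) := by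
        rw [ENNReal.tsum_mul_right, hsum, Finset.sum_const, nsmul_eq_mul]; ring
    _ ≤ R ^ (p - 1) * (1 * (R * (16 * X))) := by gcongr
    _ = _ := by ring

/-- Passing from scale `j + n` at a point `b` to scale `j` at a nearby point `x`. -/
theorem avg_rpow_le_of_near {j n : ℕ} {b x : ℝ} (h : 2 ^ j * |b - x| ≤ 1) {H : ℝ → ℝ≥0∞}
    (hH : Measurable H) {u : ℝ} (hu : 1 < u) :
    avg (j + n) H b ^ u ≤ 16 ^ (u - 1) * 4 * 2 ^ n * avg j (fun t => H t ^ u) x := by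
  refine (avg_rpow_le _ hH hu b).trans ?_
  rw [mul_assoc, mul_assoc]
  gcongr
  unfold avg
  rw [← lintegral_const_mul' _ _ (by finiteness), ← lintegral_const_mul' _ _ (by simp)]
  refine lintegral_mono fun t => ?_
  rw [← mul_assoc, ← mul_assoc]
  gcongr
  calc wt (j + n) (b - t) ≤ 2 ^ n * wt j (b - t) := by
        unfold wt
        rw [show (2:ℝ≥0∞) ^ n = ENNReal.ofReal (2 ^ n) by
          rw [ENNReal.ofReal_pow (by norm_num)]; simp, ← ENNReal.ofReal_mul (by positivity)]
        refine ENNReal.ofReal_le_ofReal ?_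
        rw [← mul_div_assoc, ← pow_add, add_comm n j]
        gcongr
        · norm_num
        · omega
    _ ≤ 2 ^ n * (4 * wt j (x - t)) := by gcongr; exact wt_le_four_mul h t
    _ = _ := by ring

/-- The weighted Littlewood–Paley pieces of `g`. -/
def lpPiece (φ₀ : ℝ → ℂ) (s : ℝ) (g : ℝ → ℂ) (k : ℕ) (x : ℝ) : ℝ≥0∞ :=
  (2:ℝ≥0∞) ^ ((k:ℝ) * s) * ‖LPop φ₀ k g x‖ₑ

theorem FNorm_eq_lpPiece (φ₀ : ℝ → ℂ) {p q : ℝ} (hq : 0 ≤ q) (s : ℝ) (g : ℝ → ℂ) :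
    FNorm φ₀ p q s g = (∫⁻ x, (∑' k, lpPiece φ₀ s g k x ^ q) ^ (p / q)) ^ (1 / p) := by
  unfold FNorm lpPiece
  have h (k : ℕ) : ENNReal.ofReal ((2:ℝ) ^ ((k:ℝ) * s * q)) = ((2:ℝ≥0∞) ^ ((k:ℝ) * s)) ^ q := by
    rw [← ENNReal.ofReal_rpow_of_pos (by norm_num), ENNReal.rpow_mul]; simp
  simp only [h, ENNReal.mul_rpow_of_nonneg _ _ hq, ofReal_norm]

theorem two_rpow_add_mul (a n : ℕ) (s : ℝ) :
    (2:ℝ≥0∞) ^ (((a + n : ℕ) : ℝ) * s) = 2 ^ ((a:ℝ) * s) * ((2:ℝ≥0∞) ^ s) ^ n := by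
  rw [← ENNReal.rpow_natCast, ← ENNReal.rpow_mul, ← ENNReal.rpow_add _ _ (by simp) (by simp)]
  push_cast
  ring_nf

/-- The weighted Haar coefficient function of frequency `j`. -/
def haarLevel (s : ℝ) (E : Finset (ℕ × ℤ)) (f : ℝ → ℂ) (j : ℕ) (x : ℝ) : ℝ≥0∞ :=
  (2:ℝ≥0∞) ^ ((j:ℝ) * s) *
    ∑ e ∈ E with e.1 = j, ‖hcoef e.1 e.2 f‖ₑ * (haarIco e.1 e.2).indicator 1 x

theorem measurable_indicator_haarIco (j : ℕ) (μ : ℤ) :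
    Measurable ((haarIco j μ).indicator (1 : ℝ → ℝ≥0∞)) :=
  measurable_one.indicator (measurableSet_haarIco j μ)

theorem measurable_haarLevel (s : ℝ) (E : Finset (ℕ × ℤ)) (f : ℝ → ℂ) (j : ℕ) :
    Measurable (haarLevel s E f j) := by
  unfold haarLevel
  exact (Finset.measurable_fun_sum _ fun e _ =>
    (measurable_indicator_haarIco e.1 e.2).const_mul _).const_mul _

theorem avg_haarLevel (s : ℝ) (E : Finset (ℕ × ℤ)) (f : ℝ → ℂ) (j k : ℕ) (x : ℝ) :
    avg k (haarLevel s E f j) x = ∑ e ∈ E with e.1 = j, (2:ℝ≥0∞) ^ ((j:ℝ) * s) *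
      (‖hcoef e.1 e.2 f‖ₑ * avg k ((haarIco e.1 e.2).indicator 1) x) := by
  have hm (e : ℕ × ℤ) := measurable_indicator_haarIco e.1 e.2
  unfold haarLevel
  rw [avg_const_mul k _ (Finset.measurable_fun_sum _ fun e _ => (hm e).const_mul _),
    ← Finset.mul_sum]
  congr 1
  simp only [avg, Finset.mul_sum]
  rw [lintegral_finsetSum _ fun e _ => by have := hm e; fun_prop]
  refine Finset.sum_congr rfl fun e _ => ?_
  simp only [mul_left_comm _ ‖hcoef e.1 e.2 f‖ₑ]
  exact lintegral_const_mul _ (by have := hm e; fun_prop)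

theorem two_rpow_mul_le_geom {s : ℝ} {θ : ℝ≥0∞} (h1 : (2:ℝ≥0∞) ^ s ≤ θ)
    (h2 : (2:ℝ≥0∞) ^ (-(1 + s)) ≤ θ) (k j : ℕ) :
    (2:ℝ≥0∞) ^ ((k:ℝ) * s) * 2⁻¹ ^ (j - k) ≤ geom θ k j * 2 ^ ((j:ℝ) * s) := by
  rcases le_total j k with h | h
  · obtain ⟨n, rfl⟩ := Nat.exists_eq_add_of_le h
    rw [two_rpow_add_mul, geom, Nat.sub_eq_zero_of_le h, pow_zero, mul_one, add_zero,
      Nat.add_sub_cancel_left, mul_comm]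
    gcongr
  · obtain ⟨n, rfl⟩ := Nat.exists_eq_add_of_le h
    rw [two_rpow_add_mul, geom, Nat.sub_eq_zero_of_le h, zero_add, Nat.add_sub_cancel_left,
      mul_left_comm, ← mul_pow]
    gcongr
    calc (2:ℝ≥0∞)⁻¹ = 2 ^ (-(1 + s)) * 2 ^ s := by
          rw [← ENNReal.rpow_add _ _ (by simp) (by simp), ← ENNReal.rpow_neg_one]; ring_nf
      _ ≤ θ * 2 ^ s := by gcongr

theorem exists_lpPiece_haarProj_le {φ₀ : ℝ → ℂ} (hφsmooth : ContDiff ℝ (⊤ : ℕ∞) φ₀)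
    (hφcpt : HasCompactSupport φ₀) (hφone : ∀ ξ : ℝ, |ξ| ≤ 4/3 → φ₀ ξ = 1)
    (hφzero : ∀ ξ : ℝ, 3/2 ≤ |ξ| → φ₀ ξ = 0) :
    ∃ C : NNReal, ∀ (s : ℝ) (θ : ℝ≥0∞), (2:ℝ≥0∞) ^ s ≤ θ → (2:ℝ≥0∞) ^ (-(1 + s)) ≤ θ →
      ∀ (E : Finset (ℕ × ℤ)) (f : ℝ → ℂ) (k : ℕ) (x : ℝ), lpPiece φ₀ s (haarProj E f) k x ≤
        C * ∑' j, geom θ k j * avg k (haarLevel s E f j) x := by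
  obtain ⟨C, hC⟩ := exists_enorm_LPop_haarFn_le hφsmooth hφcpt hφone hφzero
  refine ⟨C, fun s θ h1 h2 E f k x => ?_⟩
  calc lpPiece φ₀ s (haarProj E f) k x
      ≤ 2 ^ ((k:ℝ) * s) * ∑ e ∈ E, ‖hcoef e.1 e.2 f‖ₑ * (C * 2⁻¹ ^ (e.1 - k) *
          avg k ((haarIco e.1 e.2).indicator 1) x) := by
        unfold lpPiece
        gcongr
        refine (enorm_LPop_haarProj_le hφsmooth hφcpt hφone hφzero E f k x).trans ?_
        gcongr with e _
        exact hC k e.1 e.2 x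
    _ ≤ C * ∑ e ∈ E, geom θ k e.1 * (2 ^ ((e.1:ℝ) * s) *
          (‖hcoef e.1 e.2 f‖ₑ * avg k ((haarIco e.1 e.2).indicator 1) x)) := by
        rw [Finset.mul_sum, Finset.mul_sum]
        refine Finset.sum_le_sum fun e _ => ?_
        calc _ = C * ((2 ^ ((k:ℝ) * s) * 2⁻¹ ^ (e.1 - k)) *
              (‖hcoef e.1 e.2 f‖ₑ * avg k ((haarIco e.1 e.2).indicator 1) x)) := by ring
          _ ≤ C * ((geom θ k e.1 * 2 ^ ((e.1:ℝ) * s)) *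
              (‖hcoef e.1 e.2 f‖ₑ * avg k ((haarIco e.1 e.2).indicator 1) x)) := by
              exact mul_le_mul_right (mul_le_mul_left (two_rpow_mul_le_geom h1 h2 k e.1) _) _
          _ = _ := by ring
    _ = C * ∑ j ∈ HFset E, geom θ k j * avg k (haarLevel s E f j) x := by
        rw [← Finset.sum_fiberwise_of_maps_to (g := Prod.fst) (t := HFset E)
          fun e he => Finset.mem_image_of_mem _ he]
        congr 1
        refine Finset.sum_congr rfl fun j _ => ?_
        rw [avg_haarLevel, Finset.mul_sum]
        refine Finset.sum_congr rfl fun e he => ?_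
        rw [(Finset.mem_filter.1 he).2]
    _ ≤ _ := by gcongr; exact ENNReal.sum_le_tsum _

theorem mem_haarIco_iff {j : ℕ} {μ : ℤ} {x : ℝ} : x ∈ haarIco j μ ↔ ⌊(2:ℝ) ^ j * x⌋ = μ := by
  have h : (0:ℝ) < 2 ^ j := by positivity
  rw [Int.floor_eq_iff, haarIco, Set.mem_Ico, dyadicPt, dyadicPt, zpow_neg, zpow_natCast,
    inv_mul_le_iff₀ h, lt_inv_mul_iff₀ h]

theorem haarLevel_eq_zero {s : ℝ} {E : Finset (ℕ × ℤ)} {f : ℝ → ℂ} {j : ℕ} {x : ℝ}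
    (h : (j, ⌊(2:ℝ) ^ j * x⌋) ∉ E) : haarLevel s E f j x = 0 := by
  unfold haarLevel
  rw [Finset.sum_eq_zero, mul_zero]
  intro e he
  rw [Finset.mem_filter] at he
  rw [Set.indicator_of_notMem, mul_zero]
  intro hx
  rw [mem_haarIco_iff, he.2] at hx
  apply h
  rw [hx, ← he.2]
  exact he.1

theorem haarLevel_le (s : ℝ) (E : Finset (ℕ × ℤ)) (f : ℝ → ℂ) (j : ℕ) (x : ℝ) :
    haarLevel s E f j x ≤ (2:ℝ≥0∞) ^ ((j:ℝ) * s) * ‖hcoef j ⌊(2:ℝ) ^ j * x⌋ f‖ₑ := by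
  by_cases h : (j, ⌊(2:ℝ) ^ j * x⌋) ∈ E
  · unfold haarLevel
    gcongr
    have hmem : (j, ⌊(2:ℝ) ^ j * x⌋) ∈ E.filter (fun e => e.1 = j) :=
      Finset.mem_filter.2 ⟨h, rfl⟩
    rw [Finset.sum_eq_single_of_mem _ hmem]
    · exact mul_le_of_le_one_right' (Set.indicator_le_self' (by simp) x)
    · intro e he hne
      rw [Finset.mem_filter] at he
      rw [Set.indicator_of_notMem, mul_zero]
      intro hx
      rw [mem_haarIco_iff, he.2] at hx
      exact hne (Prod.ext he.2 hx.symm)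
  · rw [haarLevel_eq_zero h]; exact zero_le

theorem avg_lpPiece (φ₀ : ℝ → ℂ) (s : ℝ) (g : ℝ → ℂ) (k : ℕ) (hm : Measurable (LPop φ₀ k g))
    (x : ℝ) : avg k (lpPiece φ₀ s g k) x =
      2 ^ ((k:ℝ) * s) * avg k (fun t => ‖LPop φ₀ k g t‖ₑ) x := by
  unfold lpPiece
  exact avg_const_mul k _ (by fun_prop) x

theorem le_rpow_of_rpow_le {a b : ℝ≥0∞} {u : ℝ} (hu : 0 < u) (h : a ^ u ≤ b) : a ≤ b ^ (1 / u) := by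
  rw [one_div]; exact (ENNReal.le_rpow_inv_iff hu).2 h

/-- Weighted sum of averages at the three distinguished points of a dyadic interval. -/
theorem avg_endpoints_le {j n : ℕ} {μ : ℤ} {x : ℝ} (hx : x ∈ haarIco j μ) {H : ℝ → ℝ≥0∞}
    (hH : Measurable H) {q u : ℝ} (hu : 1 < u) :
    ((2:ℝ≥0∞) ^ (-(1 / q))) ^ n * (avg (j + n) H (dyadicPt j μ) +
      avg (j + n) H (dyadicPt j (μ + 1 / 2)) + avg (j + n) H (dyadicPt j (μ + 1))) ≤
    3 * (16 ^ (u - 1) * 4) ^ (1 / u) * ((2:ℝ≥0∞) ^ (-(1 / q) + 1 / u)) ^ n *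
      (avg j (fun t => H t ^ u) x) ^ (1 / u) := by
  have hu0 : 0 ≤ 1 / u := by positivity
  have key (c : ℝ) (h0 : (μ:ℝ) ≤ c) (h1 : c ≤ μ + 1) : avg (j + n) H (dyadicPt j c) ≤
      (16 ^ (u - 1) * 4) ^ (1 / u) * ((2:ℝ≥0∞) ^ (1 / u)) ^ n *
        (avg j (fun t => H t ^ u) x) ^ (1 / u) := by
    have hnear : 2 ^ j * |dyadicPt j c - x| ≤ 1 := by
      have e : dyadicPt j (μ + 1) = dyadicPt j μ + 2 ^ (-(j:ℤ)) := by simp only [dyadicPt]; ring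
      have := dyadicPt_mono j h0
      have := dyadicPt_mono j h1
      have := hx.1
      have := hx.2
      calc (2:ℝ) ^ j * |dyadicPt j c - x| ≤ 2 ^ j * 2 ^ (-(j:ℤ)) := by
            gcongr
            rw [abs_le]; constructor <;> linarith
        _ = 1 := two_zpow_neg_mul j
    refine (le_rpow_of_rpow_le (by linarith) (avg_rpow_le_of_near hnear hH hu)).trans_eq ?_
    rw [ENNReal.mul_rpow_of_nonneg _ _ hu0, ENNReal.mul_rpow_of_nonneg _ _ hu0,
      ← ENNReal.rpow_natCast, ← ENNReal.rpow_natCast, ← ENNReal.rpow_mul, ← ENNReal.rpow_mul,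
      mul_comm (n:ℝ)]
  calc _ ≤ ((2:ℝ≥0∞) ^ (-(1 / q))) ^ n * (
      (16 ^ (u - 1) * 4) ^ (1 / u) * ((2:ℝ≥0∞) ^ (1 / u)) ^ n *
        (avg j (fun t => H t ^ u) x) ^ (1 / u) +
      (16 ^ (u - 1) * 4) ^ (1 / u) * ((2:ℝ≥0∞) ^ (1 / u)) ^ n *
        (avg j (fun t => H t ^ u) x) ^ (1 / u) +
      (16 ^ (u - 1) * 4) ^ (1 / u) * ((2:ℝ≥0∞) ^ (1 / u)) ^ n *
        (avg j (fun t => H t ^ u) x) ^ (1 / u)) :=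
        mul_le_mul_right (add_le_add (add_le_add (key _ le_rfl (by linarith))
          (key _ (by linarith) (by linarith))) (key _ (by linarith) le_rfl)) _
    _ = _ := by
        rw [ENNReal.rpow_add _ _ (by simp) (by simp), mul_pow]; ring

theorem exists_haarLevel_le {p q : ℝ} (hq : 1 < q) (hqp : q < p) {φ₀ : ℝ → ℂ}
    (hφsmooth : ContDiff ℝ (⊤ : ℕ∞) φ₀) (hφcpt : HasCompactSupport φ₀)
    (hφone : ∀ ξ : ℝ, |ξ| ≤ 4/3 → φ₀ ξ = 1) (hφzero : ∀ ξ : ℝ, 3/2 ≤ |ξ| → φ₀ ξ = 0) :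
    ∃ C : ℝ≥0∞, C ≠ ∞ ∧ ∀ f : 𝓢(ℝ, ℂ), (∀ k, Measurable (lpPiece φ₀ (-1 + 1 / q) f k)) ∧
      ∀ (E : Finset (ℕ × ℤ)) (N j : ℕ) (x : ℝ), haarLevel (-1 + 1 / q) E f j x ≤
        C * (∑' k, geom ((2:ℝ≥0∞) ^ (-1 + 1 / q)) j k * avg k (lpPiece φ₀ (-1 + 1 / q) f k) x +
          ∑ n ∈ Finset.range N,
            (avg j (fun t => lpPiece φ₀ (-1 + 1 / q) f (j + 1 + n) t ^ q) x) ^ (1 / q) +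
          ∑' m, ((2:ℝ≥0∞) ^ (-(1 / q) + 1 / p)) ^ (N + m) *
            (avg j (fun t => lpPiece φ₀ (-1 + 1 / q) f (j + 1 + N + m) t ^ p) x) ^ (1 / p)) := by
  obtain ⟨D, hD⟩ := exists_enorm_hcoef_LPop_le hφsmooth hφcpt hφone hφzero
  set s : ℝ := -1 + 1 / q with hs
  have hp : 1 < p := hq.trans hqp
  set K : ℝ → ℝ≥0∞ := fun u => 3 * (16 ^ (u - 1) * 4) ^ (1 / u) with hK
  have hKt (u : ℝ) (hu : 1 < u) : K u ≠ ∞ := by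
    have h1 : (0:ℝ) ≤ u - 1 := by linarith
    have h2 : (0:ℝ) ≤ 1 / u := by positivity
    exact ENNReal.mul_ne_top (by simp) (ENNReal.rpow_ne_top_of_nonneg h2
      (ENNReal.mul_ne_top (ENNReal.rpow_ne_top_of_nonneg h1 (by simp)) (by simp)))
  refine ⟨D * (1 + K q + K p), ENNReal.mul_ne_top (by simp) (ENNReal.add_ne_top.2
    ⟨ENNReal.add_ne_top.2 ⟨by simp, hKt q hq⟩, hKt p hp⟩), fun f => ?_⟩
  obtain ⟨hm, hsum, hlow, hhigh⟩ := hD f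
  set H := lpPiece φ₀ s f with hH
  have hHm (k : ℕ) : Measurable (H k) := by
    have := hm k
    rw [hH]; unfold lpPiece; fun_prop
  refine ⟨hHm, fun E N j x => ?_⟩
  set μ := ⌊(2:ℝ) ^ j * x⌋ with hμ
  have hx : x ∈ haarIco j μ := mem_haarIco_iff.2 rfl
  set g : ℕ → ℝ≥0∞ := fun k => 2 ^ ((j:ℝ) * s) * ‖hcoef j μ (LPop φ₀ k f)‖ₑ with hg
  have hglow (k : ℕ) (hk : k ≤ j) : g k ≤ D * (geom ((2:ℝ≥0∞) ^ s) j k * avg k (H k) x) := by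
    obtain ⟨n, rfl⟩ := Nat.exists_eq_add_of_le hk
    calc g k ≤ 2 ^ (((k + n : ℕ) : ℝ) * s) * (D * avg k (fun t => ‖LPop φ₀ k f t‖ₑ) x) := by
          simp only [hg]; gcongr; exact hlow k (k + n) μ hk x hx
      _ = _ := by
          rw [hH, avg_lpPiece φ₀ s f k (hm k), two_rpow_add_mul, geom,
            Nat.sub_eq_zero_of_le hk, Nat.add_sub_cancel_left, add_zero]
          ring
  have hgend (n : ℕ) (hn : 0 < n) : g (j + n) ≤ D * (((2:ℝ≥0∞) ^ (-(1 / q))) ^ n *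
      (avg (j + n) (H (j + n)) (dyadicPt j μ) + avg (j + n) (H (j + n)) (dyadicPt j (μ + 1 / 2)) +
        avg (j + n) (H (j + n)) (dyadicPt j (μ + 1)))) := by
    refine (mul_le_mul_right (hhigh (j + n) j μ (by omega)) _).trans_eq ?_
    have e : ((2:ℝ≥0∞) ^ (-(1 / q))) ^ n * ((2:ℝ≥0∞) ^ s) ^ n = (2⁻¹) ^ n := by
      rw [← mul_pow, ← ENNReal.rpow_add _ _ (by simp) (by simp), hs,
        show -(1 / q) + (-1 + 1 / q) = -1 by ring, ENNReal.rpow_neg_one]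
    rw [hH, avg_lpPiece φ₀ s f _ (hm _), avg_lpPiece φ₀ s f _ (hm _), avg_lpPiece φ₀ s f _ (hm _),
      two_rpow_add_mul, Nat.add_sub_cancel_left, ← e]
    ring
  have hgu (u : ℝ) (hu : 1 < u) (n : ℕ) (hn : 0 < n) : g (j + n) ≤
      D * K u * (((2:ℝ≥0∞) ^ (-(1 / q) + 1 / u)) ^ n *
        (avg j (fun t => H (j + n) t ^ u) x) ^ (1 / u)) := by
    refine (hgend n hn).trans ((mul_le_mul_right (avg_endpoints_le hx (hHm _) hu) _).trans_eq ?_)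
    simp only [hK]; ring
  have hsplit : ∑' k, g k = ∑ k ∈ Finset.range (j + 1), g k +
      ∑ n ∈ Finset.range N, g (j + 1 + n) + ∑' m, g (j + 1 + N + m) := by
    rw [← Summable.sum_add_tsum_nat_add' (k := j + 1) (f := g) ENNReal.summable,
      ← Summable.sum_add_tsum_nat_add' (k := N) (f := fun n => g (n + (j + 1))) ENNReal.summable]
    rw [← add_assoc]
    refine congrArg₂ _ (congrArg₂ _ rfl (Finset.sum_congr rfl fun n _ => ?_))
      (tsum_congr fun m => ?_) <;> exact congrArg g (by omega)
  have hle : haarLevel s E f j x ≤ ∑' k, g k := by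
    refine (haarLevel_le s E f j x).trans ?_
    rw [hg, ENNReal.tsum_mul_left]
    gcongr
    exact hsum j μ
  have hθ' : (2:ℝ≥0∞) ^ (-(1 / q) + 1 / p) ≤ 1 := by
    rw [← ENNReal.rpow_zero (x := 2)]
    refine ENNReal.rpow_le_rpow_of_exponent_le (by simp) ?_
    have : 1 / p ≤ 1 / q := one_div_le_one_div_of_le (by linarith) hqp.le
    linarith
  refine hle.trans ?_
  rw [hsplit, mul_add (D * (1 + K q + K p)), mul_add (D * (1 + K q + K p))]
  refine add_le_add (add_le_add ?_ ?_) ?_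
  · calc ∑ k ∈ Finset.range (j + 1), g k
        ≤ ∑ k ∈ Finset.range (j + 1), D * (geom ((2:ℝ≥0∞) ^ s) j k * avg k (H k) x) :=
          Finset.sum_le_sum fun k hk => hglow k (Nat.lt_succ_iff.1 (Finset.mem_range.1 hk))
      _ ≤ D * ∑' k, geom ((2:ℝ≥0∞) ^ s) j k * avg k (H k) x := by
          rw [← Finset.mul_sum]; gcongr; exact ENNReal.sum_le_tsum _
      _ ≤ _ := by
          gcongr
          refine le_mul_of_one_le_right' ?_
          rw [add_assoc]; exact le_self_add
  · rw [Finset.mul_sum]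
    refine Finset.sum_le_sum fun n _ => ?_
    have h := hgu q hq (1 + n) (by omega)
    rw [neg_add_cancel, ENNReal.rpow_zero, one_pow, one_mul, ← add_assoc] at h
    refine h.trans ?_
    gcongr
    rw [add_comm 1, add_assoc]
    exact le_self_add
  · rw [← ENNReal.tsum_mul_left]
    refine ENNReal.tsum_le_tsum fun m => ?_
    have h := hgu p hp (1 + N + m) (by omega)
    rw [← add_assoc, ← add_assoc] at h
    have hpow := pow_le_pow_right_of_le_one' hθ' (show N + m ≤ 1 + N + m by omega)
    exact h.trans (mul_le_mul' (mul_le_mul_right le_add_self _) (mul_le_mul_left hpow _))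

theorem add_add_rpow_le (a b c : ℝ≥0∞) {u : ℝ} (hu : 0 ≤ u) :
    (a + b + c) ^ u ≤ 3 ^ u * (a ^ u + b ^ u + c ^ u) := by
  have key (m : ℝ≥0∞) (ha : a ≤ m) (hb : b ≤ m) (hc : c ≤ m)
      (hm : m ^ u ≤ a ^ u + b ^ u + c ^ u) :
      (a + b + c) ^ u ≤ 3 ^ u * (a ^ u + b ^ u + c ^ u) := by
    calc (a + b + c) ^ u ≤ (3 * m) ^ u := by
          refine ENNReal.rpow_le_rpow ((add_le_add (add_le_add ha hb) hc).trans_eq ?_) hu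
          ring
      _ = 3 ^ u * m ^ u := ENNReal.mul_rpow_of_nonneg _ _ hu
      _ ≤ _ := by gcongr
  rcases le_total a b with hab | hab <;> rcases le_total b c with hbc | hbc <;>
    rcases le_total a c with hac | hac
  · exact key c hac hbc le_rfl le_add_self
  · exact key c (hab.trans hbc) hbc le_rfl le_add_self
  · exact key b hab le_rfl hbc (le_add_self.trans le_self_add)
  · exact key b hab le_rfl hbc (le_add_self.trans le_self_add)
  · exact key c hac hbc le_rfl le_add_self
  · exact key a le_rfl hab hac (by rw [add_assoc]; exact le_self_add)
  · exact key a le_rfl hab (hbc.trans hab) (by rw [add_assoc]; exact le_self_add)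
  · exact key a le_rfl hab hac (by rw [add_assoc]; exact le_self_add)

theorem lintegral_sum_mul_add_add_rpow_le {q r : ℝ} (hq : 0 ≤ q) (hr : 0 ≤ r) {K : ℝ≥0∞}
    (hK : K ≠ ∞) (A : Finset ℕ) {a b : ℕ → ℝ → ℝ≥0∞} (c : ℕ → ℝ → ℝ≥0∞) (ha : ∀ j, Measurable (a j))
    (hb : ∀ j, Measurable (b j)) :
    ∫⁻ x, (∑ j ∈ A, (K * (a j x + b j x + c j x)) ^ q) ^ r ≤
      ((K ^ q * 3 ^ q) ^ r * 3 ^ r) * ((∫⁻ x, (∑ j ∈ A, a j x ^ q) ^ r) +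
        (∫⁻ x, (∑ j ∈ A, b j x ^ q) ^ r) + ∫⁻ x, (∑ j ∈ A, c j x ^ q) ^ r) := by
  have hm (F : ℕ → ℝ → ℝ≥0∞) (hF : ∀ j, Measurable (F j)) :
      Measurable fun x => (∑ j ∈ A, F j x ^ q) ^ r :=
    (Finset.measurable_fun_sum _ fun j _ => (hF j).pow_const q).pow_const r
  have hconst : (K ^ q * 3 ^ q) ^ r * 3 ^ r ≠ ∞ := by
    refine ENNReal.mul_ne_top (ENNReal.rpow_ne_top_of_nonneg hr (ENNReal.mul_ne_top ?_ ?_)) ?_ <;>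
      apply ENNReal.rpow_ne_top_of_nonneg <;> simp [*]
  rw [← lintegral_add_left (hm a ha), ← lintegral_add_left (by exact (hm a ha).add (hm b hb)),
    ← lintegral_const_mul' _ _ hconst]
  refine lintegral_mono fun x => ?_
  calc (∑ j ∈ A, (K * (a j x + b j x + c j x)) ^ q) ^ r
      ≤ (∑ j ∈ A, K ^ q * 3 ^ q * (a j x ^ q + b j x ^ q + c j x ^ q)) ^ r := by
        refine ENNReal.rpow_le_rpow (Finset.sum_le_sum fun j _ => ?_) hr
        rw [ENNReal.mul_rpow_of_nonneg _ _ hq, mul_assoc]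
        exact mul_le_mul_right (add_add_rpow_le _ _ _ hq) _
    _ = (K ^ q * 3 ^ q) ^ r * (∑ j ∈ A, a j x ^ q + ∑ j ∈ A, b j x ^ q +
          ∑ j ∈ A, c j x ^ q) ^ r := by
        rw [← Finset.mul_sum, ENNReal.mul_rpow_of_nonneg _ _ hr, Finset.sum_add_distrib,
          Finset.sum_add_distrib]
    _ ≤ _ := by
        rw [mul_assoc]
        exact mul_le_mul_right (add_add_rpow_le _ _ _ hr) _

theorem exists_lintegral_haarLevel_le {p q : ℝ} (hq : 1 < q) (hqp : q < p) {φ₀ : ℝ → ℂ}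
    (hφsmooth : ContDiff ℝ (⊤ : ℕ∞) φ₀) (hφcpt : HasCompactSupport φ₀)
    (hφone : ∀ ξ : ℝ, |ξ| ≤ 4/3 → φ₀ ξ = 1) (hφzero : ∀ ξ : ℝ, 3/2 ≤ |ξ| → φ₀ ξ = 0) :
    ∃ K : ℝ≥0∞, K ≠ ∞ ∧ ∀ (E : Finset (ℕ × ℤ)) (f : 𝓢(ℝ, ℂ)) (N c : ℕ),
      (∀ k, ((HFset E).filter (fun j => j < k ∧ k ≤ j + N)).card ≤ c) →
      ((HFset E).card : ℝ≥0∞) * ((2:ℝ≥0∞) ^ (-(1 / q) + 1 / p)) ^ N ≤ 1 →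
      ∫⁻ x, (∑' j, haarLevel (-1 + 1 / q) E f j x ^ q) ^ (p / q) ≤
        K * (1 + ((N:ℝ≥0∞) ^ (q - 1) * c) ^ (p / q)) *
          ∫⁻ x, (∑' k, lpPiece φ₀ (-1 + 1 / q) f k x ^ q) ^ (p / q) := by
  have hr : 1 < p / q := (one_lt_div (by linarith)).2 hqp
  have hlt {t : ℝ} (ht : t < 0) : (2:ℝ≥0∞) ^ t < 1 :=
    ENNReal.rpow_lt_one_of_one_lt_of_neg (by norm_num) ht
  have hq1 : 1 / q < 1 := (div_lt_one (by linarith)).2 hq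
  have hpq : 1 / p < 1 / q := one_div_lt_one_div_of_lt (by linarith) hqp
  obtain ⟨K₀, hK₀, hlevel⟩ := exists_haarLevel_le hq hqp hφsmooth hφcpt hφone hφzero
  obtain ⟨K₁, hK₁, hlow⟩ := exists_lintegral_tsum_geom_avg_le' hq hr
    (hlt (show -1 + 1 / q < 0 by linarith))
  obtain ⟨K₂, hK₂, hmid⟩ := exists_lintegral_middle_le hq hr
  obtain ⟨K₃, hK₃, hhigh⟩ := exists_lintegral_high_le hq hqp
    (hlt (show -(1 / q) + 1 / p < 0 by linarith))
  have hq0 : 0 ≤ q := by linarith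
  have hr0 : 0 ≤ p / q := by linarith
  set K : ℝ≥0∞ := (K₀ ^ q * 3 ^ q) ^ (p / q) * 3 ^ (p / q) with hK
  have hKt : K ≠ ∞ := by
    refine ENNReal.mul_ne_top (ENNReal.rpow_ne_top_of_nonneg hr0 (ENNReal.mul_ne_top ?_ ?_)) ?_ <;>
      apply ENNReal.rpow_ne_top_of_nonneg <;> simp [*]
  refine ⟨K * (K₁ + K₂ + K₃), ENNReal.mul_ne_top hKt (by simp [*]), fun E f N c hc hN => ?_⟩
  obtain ⟨hHm, hle⟩ := hlevel f
  set H := lpPiece φ₀ (-1 + 1 / q) f with hH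
  set A := HFset E with hA
  have hzero (j : ℕ) (hj : j ∉ A) (x : ℝ) : haarLevel (-1 + 1 / q) E f j x = 0 :=
    haarLevel_eq_zero fun h => hj (Finset.mem_image_of_mem Prod.fst h)
  calc ∫⁻ x, (∑' j, haarLevel (-1 + 1 / q) E f j x ^ q) ^ (p / q)
      = ∫⁻ x, (∑ j ∈ A, haarLevel (-1 + 1 / q) E f j x ^ q) ^ (p / q) := by
        congr 1 with x
        rw [tsum_eq_sum fun j hj => ?_]
        rw [hzero j hj, ENNReal.zero_rpow_of_pos (by linarith)]
    _ ≤ _ := lintegral_mono fun x => ENNReal.rpow_le_rpow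
        (Finset.sum_le_sum fun j _ => ENNReal.rpow_le_rpow (hle E N j x) hq0) hr0
    _ ≤ _ := lintegral_sum_mul_add_add_rpow_le hq0 hr0 hK₀ A _
        (fun j => Measurable.tsum fun k => (measurable_avg k (hHm k)).const_mul _)
        (fun j => Finset.measurable_fun_sum _ fun n _ =>
          (measurable_avg j ((hHm _).pow_const q)).pow_const _)
    _ ≤ K * (K₁ * (∫⁻ x, (∑' k, H k x ^ q) ^ (p / q)) +
          K₂ * ((N:ℝ≥0∞) ^ (q - 1) * c) ^ (p / q) * (∫⁻ x, (∑' k, H k x ^ q) ^ (p / q)) +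
          K₃ * ∫⁻ x, (∑' k, H k x ^ q) ^ (p / q)) := by
        refine mul_le_mul_right (add_le_add (add_le_add (le_trans ?_ (hlow H hHm))
          (hmid A N c hc H hHm)) (hhigh A N hN H hHm)) _
        exact lintegral_mono fun x => ENNReal.rpow_le_rpow (ENNReal.sum_le_tsum _) hr0
    _ ≤ K * ((K₁ + K₂ + K₃) * (1 + ((N:ℝ≥0∞) ^ (q - 1) * c) ^ (p / q)) *
          ∫⁻ x, (∑' k, H k x ^ q) ^ (p / q)) := by
        rw [← add_mul, ← add_mul]
        gcongr
        rw [mul_add, mul_one, add_mul, add_mul]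
        calc _ = (K₁ + K₃) + K₂ * ((N:ℝ≥0∞) ^ (q - 1) * c) ^ (p / q) := by ring
          _ ≤ (K₁ + K₂ + K₃) + K₂ * ((N:ℝ≥0∞) ^ (q - 1) * c) ^ (p / q) := by
              gcongr; exact le_self_add
          _ ≤ _ := by
              gcongr
              rw [add_right_comm]
              exact le_add_self
    _ = _ := by ring

theorem card_window_le_Zbar (A : Finset ℕ) (n : ℤ) :
    (A.filter (fun (j : ℕ) => |(j:ℝ) - (n:ℝ)| ≤ Real.logb 2 (A.card : ℝ))).card ≤ Zbar A := by
  refine le_csSup ⟨A.card, ?_⟩ ⟨n, rfl⟩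
  rintro c ⟨n, rfl⟩
  exact Finset.card_filter_le _ _

theorem one_le_Zbar {A : Finset ℕ} (hA : A.Nonempty) : 1 ≤ Zbar A := by
  obtain ⟨j, hj⟩ := hA
  refine le_trans (Finset.card_pos.2 ⟨j, ?_⟩) (card_window_le_Zbar A (j : ℤ))
  have : 0 ≤ Real.logb 2 (A.card : ℝ) := Real.logb_nonneg (by norm_num)
    (by exact_mod_cast Finset.card_pos.2 ⟨j, hj⟩)
  simp [hj, this]

theorem card_filter_lt_le_mul_Zbar {A : Finset ℕ} (hA : 2 ≤ A.card) {N T : ℕ} {R : ℝ}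
    (hN : (N : ℝ) ≤ R * Real.logb 2 A.card) (hT : 2 * R ≤ T) (k : ℕ) :
    (A.filter (fun j => j < k ∧ k ≤ j + N)).card ≤ T * Zbar A := by
  set L := Real.logb 2 (A.card : ℝ) with hL
  have hL1 : 1 ≤ L := by
    rw [hL, Real.le_logb_iff_rpow_le (by norm_num) (by positivity), Real.rpow_one]
    exact_mod_cast hA
  set m := ⌊L⌋₊ with hm
  have hm1 : 1 ≤ m := Nat.one_le_floor_iff _ |>.2 hL1
  have hmL : (m:ℝ) ≤ L := Nat.floor_le (by linarith)
  have hLm : L < m + 1 := Nat.lt_floor_add_one L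
  have hm1' : (1:ℝ) ≤ m := by exact_mod_cast hm1
  have hR : 0 ≤ R := by
    by_contra h
    have : R * L < 0 := mul_neg_of_neg_of_pos (by linarith) (by linarith)
    linarith [Nat.cast_nonneg (α := ℝ) N]
  have hNT : N ≤ T * m := by
    have : (N:ℝ) ≤ T * m := by nlinarith
    exact_mod_cast this
  have hsub : A.filter (fun j => j < k ∧ k ≤ j + N) ⊆ (Finset.range T).biUnion fun i =>
      A.filter (fun (j : ℕ) => |(j:ℝ) - (((k:ℤ) - 1 - i * m : ℤ) : ℝ)| ≤ L) := by
    intro j hj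
    obtain ⟨hjA, hjk, hkj⟩ := Finset.mem_filter.1 hj
    refine Finset.mem_biUnion.2 ⟨(k - 1 - j) / m, ?_, Finset.mem_filter.2 ⟨hjA, ?_⟩⟩
    · rw [Finset.mem_range, Nat.div_lt_iff_lt_mul (by omega)]
      omega
    · have h1 := Nat.div_add_mod (k - 1 - j) m
      have h2 := Nat.mod_lt (k - 1 - j) (show 0 < m by omega)
      set i := (k - 1 - j) / m
      set t := (k - 1 - j) % m
      have h3 : (m:ℝ) * i + t = k - 1 - j := by
        have : m * i + t + 1 + j = k := by omega
        have : (m:ℝ) * i + t + 1 + j = k := by exact_mod_cast this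
        linarith
      have h4 : (t:ℝ) ≤ m := by exact_mod_cast h2.le
      have h5 : (0:ℝ) ≤ t := Nat.cast_nonneg t
      push_cast
      rw [abs_le]
      constructor <;> linarith
  calc _ ≤ _ := Finset.card_le_card hsub
    _ ≤ ∑ i ∈ Finset.range T, _ := Finset.card_biUnion_le
    _ ≤ ∑ i ∈ Finset.range T, Zbar A := Finset.sum_le_sum fun i _ => card_window_le_Zbar A _
    _ = _ := by simp

/-- Endpoint upper bound, $1<q<p<\infty$, $s=-1+1/q$:
$\|P_E f\|\le C(\log_2\#A)^{1-1/q}\,\bar{\mathcal Z}(A)^{1/q}\|f\|$ with $A=\mathrm{HF}(E)$. -/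
theorem haar_projection_endpoint_upper_bound_qp
    (p q : ℝ) (hq : 1 < q) (hqp : q < p)
    (φ₀ : ℝ → ℂ) (hφsmooth : ContDiff ℝ (⊤ : ℕ∞) φ₀) (hφcpt : HasCompactSupport φ₀)
    (hφone : ∀ ξ : ℝ, |ξ| ≤ 4/3 → φ₀ ξ = 1)
    (hφzero : ∀ ξ : ℝ, 3/2 ≤ |ξ| → φ₀ ξ = 0) :
    ∃ C : ℝ, 0 < C ∧ ∀ (E : Finset (ℕ × ℤ)), 2 ≤ (HFset E).card →
      ∀ f : SchwartzMap ℝ ℂ,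
      FNorm φ₀ p q (-1 + 1/q) (haarProj E f) ≤
        ENNReal.ofReal (C * (Real.logb 2 ((HFset E).card : ℝ))^(1 - 1/q) *
          (Zbar (HFset E) : ℝ)^(1/q)) * FNorm φ₀ p q (-1 + 1/q) f := by
  have hr : 1 < p / q := (one_lt_div (by linarith)).2 hqp
  have hlt {t : ℝ} (ht : t < 0) : (2:ℝ≥0∞) ^ t < 1 :=
    ENNReal.rpow_lt_one_of_one_lt_of_neg (by norm_num) ht
  have hq0 : 0 < q := by linarith
  have hp0 : 0 < p := by linarith
  have hr0 : 0 ≤ p / q := by linarith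
  have hq1 : 1 / q < 1 := (div_lt_one hq0).2 hq
  have hqi : 0 < 1 / q := by positivity
  have hpi : 0 ≤ 1 / p := by positivity
  have hpq : 1 / p < 1 / q := one_div_lt_one_div_of_lt hq0 hqp
  obtain ⟨D, hD⟩ := exists_lpPiece_haarProj_le hφsmooth hφcpt hφone hφzero
  set θ : ℝ≥0∞ := max ((2:ℝ≥0∞) ^ (-1 + 1 / q)) ((2:ℝ≥0∞) ^ (-(1 + (-1 + 1 / q)))) with hθ
  have hθ1 : θ < 1 := max_lt (hlt (by linarith)) (hlt (by linarith))
  obtain ⟨K₁, hK₁, hout⟩ := exists_lintegral_tsum_geom_avg_le hq hr hθ1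
  obtain ⟨K₂, hK₂, hin⟩ := exists_lintegral_haarLevel_le hq hqp hφsmooth hφcpt hφone hφzero
  set ε : ℝ := 1 / q - 1 / p with hε
  have hε0 : 0 < ε := by linarith
  set R : ℝ := 1 / ε + 1 with hR
  have hR0 : 0 < R := by positivity
  set T : ℕ := ⌈2 * R⌉₊ with hT
  set B : ℝ≥0∞ := ENNReal.ofReal (R ^ (q - 1) * T) with hB
  set K : ℝ≥0∞ := (D ^ q) ^ (p / q) * K₁ * (K₂ * (1 + B ^ (p / q))) with hK
  have hKt : K ≠ ∞ := by
    have hBt : B ^ (p / q) ≠ ∞ := ENNReal.rpow_ne_top_of_nonneg hr0 ENNReal.ofReal_ne_top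
    have hDt : ((D:ℝ≥0∞) ^ q) ^ (p / q) ≠ ∞ :=
      ENNReal.rpow_ne_top_of_nonneg hr0 (ENNReal.rpow_ne_top_of_nonneg hq0.le (by simp))
    exact ENNReal.mul_ne_top (ENNReal.mul_ne_top hDt hK₁)
      (ENNReal.mul_ne_top hK₂ (by simp [hBt]))
  refine ⟨(K ^ (1 / p)).toReal + 1, by positivity, fun E hE f => ?_⟩
  set A := HFset E with hA
  set L := Real.logb 2 (A.card : ℝ) with hL
  have hcard : (0:ℝ) < A.card := by exact_mod_cast (show 0 < A.card by omega)
  have hL1 : 1 ≤ L := by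
    rw [hL, Real.le_logb_iff_rpow_le (by norm_num) hcard, Real.rpow_one]
    exact_mod_cast hE
  have hZ1 : (1:ℝ) ≤ Zbar A := by
    exact_mod_cast one_le_Zbar (Finset.card_pos.1 (show 0 < A.card by omega))
  set M : ℝ≥0∞ := ENNReal.ofReal (L ^ (q - 1) * Zbar A) with hM
  have hM1 : 1 ≤ M := by
    rw [hM, ENNReal.one_le_ofReal]
    exact one_le_mul_of_one_le_of_one_le (Real.one_le_rpow hL1 (by linarith)) hZ1
  set N : ℕ := ⌈L / ε⌉₊ with hN
  have hNR : (N:ℝ) ≤ R * L := by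
    have h1 := Nat.ceil_lt_add_one (show 0 ≤ L / ε by positivity)
    have h2 : R * L = L / ε + L := by rw [hR]; ring
    linarith
  have hcount := card_filter_lt_le_mul_Zbar hE hNR (Nat.le_ceil (2 * R))
  have hsmall : (A.card : ℝ≥0∞) * ((2:ℝ≥0∞) ^ (-(1 / q) + 1 / p)) ^ N ≤ 1 := by
    have h1 : (A.card : ℝ≥0∞) = 2 ^ L := by
      rw [← ENNReal.ofReal_natCast, ← Real.rpow_logb (b := 2) (by norm_num) (by norm_num) hcard,
        ← ENNReal.ofReal_rpow_of_pos (by norm_num)]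
      simp [hL]
    rw [h1, ← ENNReal.rpow_natCast, ← ENNReal.rpow_mul, ← ENNReal.rpow_add _ _ (by simp) (by simp),
      ← ENNReal.rpow_zero (x := 2)]
    refine ENNReal.rpow_le_rpow_of_exponent_le (by simp) ?_
    have h2 : L ≤ N * ε := (div_le_iff₀ hε0).1 (Nat.le_ceil _)
    have h3 : (-(1 / q) + 1 / p) * N = -(N * ε) := by rw [hε]; ring
    linarith
  have hNM : (N:ℝ≥0∞) ^ (q - 1) * ((T * Zbar A : ℕ) : ℝ≥0∞) ≤ B * M := by
    rw [hB, hM, ← ENNReal.ofReal_mul (by positivity), ← ENNReal.ofReal_natCast,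
      ← ENNReal.ofReal_natCast, ENNReal.ofReal_rpow_of_nonneg (by positivity) (by linarith),
      ← ENNReal.ofReal_mul (by positivity)]
    refine ENNReal.ofReal_le_ofReal ?_
    calc (N:ℝ) ^ (q - 1) * ((T * Zbar A : ℕ) : ℝ)
        ≤ (R * L) ^ (q - 1) * ((T * Zbar A : ℕ) : ℝ) := by
          gcongr
      _ = _ := by
          rw [Real.mul_rpow hR0.le (by linarith)]
          push_cast
          ring
  have hfactor : 1 + ((N:ℝ≥0∞) ^ (q - 1) * ((T * Zbar A : ℕ) : ℝ≥0∞)) ^ (p / q) ≤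
      (1 + B ^ (p / q)) * M ^ (p / q) := by
    rw [add_mul, one_mul, ← ENNReal.mul_rpow_of_nonneg _ _ hr0]
    exact add_le_add (ENNReal.one_le_rpow hM1 (by linarith)) (ENNReal.rpow_le_rpow hNM hr0)
  set X := ∫⁻ x, (∑' k, lpPiece φ₀ (-1 + 1 / q) f k x ^ q) ^ (p / q) with hX
  have hmain : ∫⁻ x, (∑' k, lpPiece φ₀ (-1 + 1 / q) (haarProj E f) k x ^ q) ^ (p / q) ≤
      K * M ^ (p / q) * X := by
    calc ∫⁻ x, (∑' k, lpPiece φ₀ (-1 + 1 / q) (haarProj E f) k x ^ q) ^ (p / q)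
        ≤ ∫⁻ x, (D ^ q) ^ (p / q) * (∑' k, (∑' j, geom θ k j *
            avg k (haarLevel (-1 + 1 / q) E f j) x) ^ q) ^ (p / q) := by
          refine lintegral_mono fun x => ?_
          rw [← ENNReal.mul_rpow_of_nonneg _ _ hr0, ← ENNReal.tsum_mul_left]
          refine ENNReal.rpow_le_rpow (ENNReal.tsum_le_tsum fun k => ?_) hr0
          rw [← ENNReal.mul_rpow_of_nonneg _ _ hq0.le]
          exact ENNReal.rpow_le_rpow
            (hD _ θ (le_max_left _ _) (le_max_right _ _) E f k x) hq0.le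
      _ = (D ^ q) ^ (p / q) * ∫⁻ x, (∑' k, (∑' j, geom θ k j *
            avg k (haarLevel (-1 + 1 / q) E f j) x) ^ q) ^ (p / q) :=
          lintegral_const_mul' _ _ (ENNReal.rpow_ne_top_of_nonneg hr0
            (ENNReal.rpow_ne_top_of_nonneg hq0.le (by simp)))
      _ ≤ (D ^ q) ^ (p / q) * (K₁ * (K₂ * ((1 + B ^ (p / q)) * M ^ (p / q)) * X)) := by
          refine mul_le_mul_right ((hout _ (measurable_haarLevel _ E f)).trans
            (mul_le_mul_right ((hin E f N _ hcount hsmall).trans ?_) _)) _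
          exact mul_le_mul_left (mul_le_mul_right hfactor _) _
      _ = _ := by rw [hK]; ring
  rw [FNorm_eq_lpPiece φ₀ hq0.le, FNorm_eq_lpPiece φ₀ hq0.le]
  have hMq : M ^ (1 / q) = ENNReal.ofReal (L ^ (1 - 1 / q) * (Zbar A : ℝ) ^ (1 / q)) := by
    rw [hM, ENNReal.ofReal_rpow_of_nonneg (by positivity) hqi.le,
      Real.mul_rpow (by positivity) (by positivity), ← Real.rpow_mul (by linarith),
      show (q - 1) * (1 / q) = 1 - 1 / q by field_simp]
  calc _ ≤ (K * M ^ (p / q) * X) ^ (1 / p) := ENNReal.rpow_le_rpow hmain hpi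
    _ = K ^ (1 / p) * M ^ (1 / q) * X ^ (1 / p) := by
        rw [ENNReal.mul_rpow_of_nonneg _ _ hpi, ENNReal.mul_rpow_of_nonneg _ _ hpi,
          ← ENNReal.rpow_mul, show p / q * (1 / p) = 1 / q by field_simp]
    _ ≤ _ := by
        rw [hMq, mul_assoc ((K ^ (1 / p)).toReal + 1),
          ENNReal.ofReal_mul (p := (K ^ (1 / p)).toReal + 1) (by positivity)]
        refine mul_le_mul_left (mul_le_mul_left ?_ _) _
        rw [ENNReal.le_ofReal_iff_toReal_le (ENNReal.rpow_ne_top_of_nonneg hpi hKt)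
          (by positivity)]
        linarith
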